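/- arXiv:2312.05590 — 7 statements merged into one kernel-verified Lean document; each statement's English description precedes it below -/
import Mathlib

section
/- Let d ≥ 1, let 2 ≤ p < ∞ and 1 < q ≤ 2 with 1/p + 1/q = 1, and define h(w) = ‖w‖_q²/(2(q−1)) and h*(z) = ‖z‖_p²/(2(p−1)) on ℝ^d. Then (i) h is 1-strongly convex with respect to ‖·‖_q, i.e. for all w, v ∈ ℝ^d, h(v) ≥ h(w) + ⟨∇h(w), v − w⟩ + (1/2)‖v − w‖_q²; and (ii) h* is 1-smooth with respect to ‖·‖_p, i.e. for all z, z′ ∈ ℝ^d, h*(z′) ≤ h*(z) + ⟨∇h*(z), z′ − z⟩ + (1/2)‖z′ − z‖_p². -/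
noncomputable section

open Real

/-- The ℓ_p norm of a vector in ℝ^d, for a real exponent `p`. -/
def lpNorm {d : ℕ} (p : ℝ) (x : Fin d → ℝ) : ℝ :=
  (∑ i, |x i| ^ p) ^ (1 / p)

/-- The signed power `x^α := (sgn(x_i)|x_i|^α)_i` of a vector. -/
def sgnPow {d : ℕ} (α : ℝ) (x : Fin d → ℝ) : Fin d → ℝ :=
  fun i => Real.sign (x i) * |x i| ^ α

lemma hasDerivAt_phi (p : ℝ) (hp : 2 ≤ p) (x : ℝ) :
    HasDerivAt (fun x : ℝ => |x| ^ (p - 2) * x) ((p - 1) * |x| ^ (p - 2)) x := by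
  rcases hp.eq_or_lt with rfl | hp
  · norm_num
    exact hasDerivAt_id x
  rcases lt_trichotomy x 0 with hx | rfl | hx
  · have h1 : HasDerivAt (fun y : ℝ => -((-y) ^ (p - 1))) (-((-1) * (p - 1) * (-x) ^ (p - 1 - 1))) x :=
      ((hasDerivAt_neg x).rpow_const (Or.inl (by linarith))).neg
    have h2 : (fun y : ℝ => |y| ^ (p - 2) * y) =ᶠ[nhds x] (fun y : ℝ => -((-y) ^ (p - 1))) := by
      filter_upwards [Iio_mem_nhds hx] with y hy
      have hy' : (0:ℝ) < -y := by simpa using hy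
      rw [abs_of_neg hy, show p - 1 = (p - 2) + 1 by ring, Real.rpow_add_one hy'.ne']
      ring
    refine (h1.congr_of_eventuallyEq h2).congr_deriv ?_
    rw [abs_of_neg hx, show p - 1 - 1 = p - 2 by ring]; ring
  · rw [abs_zero, Real.zero_rpow (by linarith), mul_zero]
    rw [hasDerivAt_iff_tendsto_slope]
    have hc : Filter.Tendsto (fun y : ℝ => |y| ^ (p - 2)) (nhds 0) (nhds 0) := by
      have : ContinuousAt (fun y : ℝ => |y| ^ (p - 2)) 0 :=
        (continuous_abs.continuousAt).rpow_const (Or.inr (by linarith))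
      have h3 := this.tendsto
      rwa [abs_zero, Real.zero_rpow (by linarith)] at h3
    refine (hc.mono_left nhdsWithin_le_nhds).congr' ?_
    filter_upwards [self_mem_nhdsWithin] with y hy
    have hy : y ≠ 0 := hy
    simp [slope_def_field, hy]
  · have h1 : HasDerivAt (fun y : ℝ => (y ^ (p - 1))) ((p - 1) * x ^ (p - 1 - 1)) x := by
      simpa using (hasDerivAt_id x).rpow_const (p := p - 1) (Or.inl hx.ne')
    have h2 : (fun y : ℝ => |y| ^ (p - 2) * y) =ᶠ[nhds x] (fun y : ℝ => (y ^ (p - 1))) := by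
      filter_upwards [Ioi_mem_nhds hx] with y hy
      have hy : 0 < y := hy
      rw [abs_of_pos hy, show p - 1 = (p - 2) + 1 by ring, Real.rpow_add_one hy.ne']
    refine (h1.congr_of_eventuallyEq h2).congr_deriv ?_
    rw [abs_of_pos hx, show p - 1 - 1 = p - 2 by ring]

lemma holder_aux {d : ℕ} (p : ℝ) (hp : 2 ≤ p) (a u : Fin d → ℝ) :
    ∑ i, |a i| ^ (p - 2) * (u i) ^ 2 ≤
      (∑ i, |a i| ^ p) ^ (1 - 2 / p) * (∑ i, |u i| ^ p) ^ (2 / p) := by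
  rcases hp.eq_or_lt with rfl | hp
  · simp
  have hc : (p / (p - 2)).HolderConjugate (p / 2) := by
    rw [Real.holderConjugate_iff]
    refine ⟨by rw [lt_div_iff₀ (by linarith)]; linarith, ?_⟩
    have : p - 2 ≠ 0 := by linarith
    have : p ≠ 0 := by linarith
    field_simp; ring
  have := Real.inner_le_Lp_mul_Lq Finset.univ (fun i => |a i| ^ (p - 2)) (fun i => (u i) ^ 2) hc
  refine this.trans (le_of_eq ?_)
  have e1 : ∀ i, |(|a i| ^ (p - 2))| ^ (p / (p - 2)) = |a i| ^ p := fun i => by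
    rw [abs_of_nonneg (by positivity), ← Real.rpow_mul (abs_nonneg _)]
    congr 1; field_simp [show p - 2 ≠ 0 by linarith]
  have e2 : ∀ i, |(u i) ^ 2| ^ (p / 2) = |u i| ^ p := fun i => by
    rw [abs_pow, ← Real.rpow_natCast, ← Real.rpow_mul (abs_nonneg _)]
    congr 1; push_cast; ring
  simp only [e1, e2]
  congr 2
  · field_simp [show p - 2 ≠ 0 by linarith]
  · field_simp

lemma taylor_aux (g G K : ℝ → ℝ) (c : ℝ) (hg : ∀ t, HasDerivAt g (G t) t)
    (hG : ∀ t, HasDerivAt G (K t) t) (hK : ∀ t, K t ≤ 2 * c) :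
    g 1 ≤ g 0 + G 0 + c := by
  have h1 : Antitone (fun t => G t - 2 * c * t) := by
    refine antitone_of_hasDerivAt_nonpos (f' := fun t => K t - 2 * c * 1) (fun t => ?_) (fun t => ?_)
    · exact (hG t).sub ((hasDerivAt_id t).const_mul (2 * c))
    · have := hK t
      show K t - 2 * c * 1 ≤ 0
      linarith
  have hF : ∀ t, HasDerivAt (fun t => g t - (G 0 * t + c * t ^ 2)) (G t - (G 0 * 1 + c * (2 * t))) t := by
    intro t
    refine (hg t).sub (((hasDerivAt_id t).const_mul (G 0)).add (HasDerivAt.const_mul c ?_))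
    simpa using hasDerivAt_pow 2 t
  have h2 : AntitoneOn (fun t => g t - (G 0 * t + c * t ^ 2)) (Set.Icc 0 1) := by
    refine antitoneOn_of_deriv_nonpos (convex_Icc 0 1) ?_ ?_ ?_
    · exact fun t _ => (hF t).continuousAt.continuousWithinAt
    · exact fun t _ => (hF t).differentiableAt.differentiableWithinAt
    · intro t ht
      rw [interior_Icc] at ht
      rw [(hF t).deriv]
      have := h1 ht.1.le
      simp only at this
      linarith
  have := h2 (a := 0) (b := 1) (by simp) (by simp) zero_le_one
  simp only at this
  linarith

lemma smooth_eps {d : ℕ} (p : ℝ) (hp : 2 ≤ p) (z u : Fin d → ℝ) (ε : ℝ) (hε : 0 < ε) :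
    ((∑ i, |z i + u i| ^ p) + ε) ^ (2 / p) ≤ ((∑ i, |z i| ^ p) + ε) ^ (2 / p)
      + 2 * (((∑ i, |z i| ^ p) + ε) ^ (2 / p - 1) * ∑ i, |z i| ^ (p - 2) * z i * u i)
      + (p - 1) * (∑ i, |u i| ^ p) ^ (2 / p) := by
  have hp0 : 0 < p := by linarith
  set S : ℝ → ℝ := fun t => (∑ i, |z i + t * u i| ^ p) + ε with hSd
  set D : ℝ → ℝ := fun t => ∑ i, |z i + t * u i| ^ (p - 2) * (z i + t * u i) * u i with hDd
  set E : ℝ → ℝ := fun t => ∑ i, |z i + t * u i| ^ (p - 2) * (u i) ^ 2 with hEd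
  have hS0 : ∀ t, 0 ≤ ∑ i, |z i + t * u i| ^ p := fun t => by positivity
  have hSp : ∀ t, 0 < S t := fun t => by have := hS0 t; simp only [S]; linarith
  have hl : ∀ i t, HasDerivAt (fun t => z i + t * u i) (u i) t := fun i t => by
    simpa using ((hasDerivAt_id t).mul_const (u i)).const_add (z i)
  have hS : ∀ t, HasDerivAt S (p * D t) t := by
    intro t
    refine HasDerivAt.congr_deriv (f' := ∑ i, p * |z i + t * u i| ^ (p - 2) * (z i + t * u i) * u i) ?_ ?_
    · refine HasDerivAt.add_const ε (HasDerivAt.fun_sum fun i _ => ?_)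
      exact (hasDerivAt_abs_rpow (z i + t * u i) (by linarith : 1 < p)).comp t (hl i t)
    · simp only [D, Finset.mul_sum]
      exact Finset.sum_congr rfl fun i _ => by ring
  have hD : ∀ t, HasDerivAt D ((p - 1) * E t) t := by
    intro t
    refine HasDerivAt.congr_deriv (f' := ∑ i, (p - 1) * |z i + t * u i| ^ (p - 2) * u i * u i) ?_ ?_
    · refine HasDerivAt.fun_sum fun i _ => HasDerivAt.mul_const ?_ (u i)
      exact (hasDerivAt_phi p hp (z i + t * u i)).comp t (hl i t)
    · simp only [E, Finset.mul_sum]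
      exact Finset.sum_congr rfl fun i _ => by ring
  have key := taylor_aux (fun t => S t ^ (2 / p)) (fun t => 2 * (S t ^ (2 / p - 1) * D t))
    (fun t => 2 * ((p * D t * (2 / p - 1) * S t ^ (2 / p - 1 - 1)) * D t
      + S t ^ (2 / p - 1) * ((p - 1) * E t)))
    ((p - 1) * (∑ i, |u i| ^ p) ^ (2 / p)) ?_ ?_ ?_
  · simpa [S, D] using key
  · intro t
    refine ((hS t).rpow_const (Or.inl (hSp t).ne')).congr_deriv ?_
    field_simp
  · intro t
    exact (((hS t).rpow_const (Or.inl (hSp t).ne')).mul (hD t)).const_mul 2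
  · intro t
    have hneg : 2 / p - 1 ≤ 0 := by
      rw [sub_nonpos, div_le_one hp0]; exact hp
    have a1 : (p * D t * (2 / p - 1) * S t ^ (2 / p - 1 - 1)) * D t ≤ 0 := by
      have : 0 ≤ p * (S t ^ (2 / p - 1 - 1)) * (D t) ^ 2 := by have := hSp t; positivity
      nlinarith
    have a2 : E t ≤ (∑ i, |z i + t * u i| ^ p) ^ (1 - 2 / p) * (∑ i, |u i| ^ p) ^ (2 / p) :=
      holder_aux p hp _ _
    have a3 : (∑ i, |z i + t * u i| ^ p) ^ (1 - 2 / p) ≤ S t ^ (1 - 2 / p) :=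
      Real.rpow_le_rpow (hS0 t) (by simp only [S]; linarith) (by linarith)
    have a4 : S t ^ (2 / p - 1) * S t ^ (1 - 2 / p) = 1 := by
      rw [← Real.rpow_add (hSp t)]; simp
    have a5 : 0 ≤ (∑ i, |u i| ^ p) ^ (2 / p) := by positivity
    have a6 : S t ^ (2 / p - 1) * E t ≤ (∑ i, |u i| ^ p) ^ (2 / p) := by
      calc S t ^ (2 / p - 1) * E t
          ≤ S t ^ (2 / p - 1) * (S t ^ (1 - 2 / p) * (∑ i, |u i| ^ p) ^ (2 / p)) := by
            refine mul_le_mul_of_nonneg_left (a2.trans (mul_le_mul_of_nonneg_right a3 a5)) ?_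
            exact Real.rpow_nonneg (hSp t).le _
        _ = _ := by rw [← mul_assoc, a4, one_mul]
    have a7 := mul_le_mul_of_nonneg_left a6 (by linarith : 0 ≤ p - 1)
    nlinarith

lemma smooth_zero {d : ℕ} (p : ℝ) (hp : 2 ≤ p) (z u : Fin d → ℝ) :
    (∑ i, |z i + u i| ^ p) ^ (2 / p) ≤ (∑ i, |z i| ^ p) ^ (2 / p)
      + 2 * ((∑ i, |z i| ^ p) ^ (2 / p - 1) * ∑ i, |z i| ^ (p - 2) * z i * u i)
      + (p - 1) * (∑ i, |u i| ^ p) ^ (2 / p) := by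
  have hp0 : 0 < p := by linarith
  have hpos : 0 ≤ 2 / p := by positivity
  have c1 : ∀ A : ℝ, Filter.Tendsto (fun ε : ℝ => (A + ε) ^ (2 / p)) (nhdsWithin 0 (Set.Ioi 0))
      (nhds (A ^ (2 / p))) := by
    intro A
    have : ContinuousAt (fun ε : ℝ => (A + ε) ^ (2 / p)) 0 :=
      ContinuousAt.rpow_const (by fun_prop) (Or.inr hpos)
    have h := this.tendsto
    rw [add_zero] at h
    exact h.mono_left nhdsWithin_le_nhds
  have c2 : Filter.Tendsto (fun ε : ℝ => ((∑ i, |z i| ^ p) + ε) ^ (2 / p - 1) *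
      ∑ i, |z i| ^ (p - 2) * z i * u i) (nhdsWithin 0 (Set.Ioi 0))
      (nhds ((∑ i, |z i| ^ p) ^ (2 / p - 1) * ∑ i, |z i| ^ (p - 2) * z i * u i)) := by
    by_cases hS : (∑ i, |z i| ^ p) = 0
    · have hz : ∀ i, z i = 0 := by
        intro i
        have := (Finset.sum_eq_zero_iff_of_nonneg (fun i _ => by positivity)).1 hS i (Finset.mem_univ i)
        rw [Real.rpow_eq_zero (abs_nonneg _) hp0.ne'] at this
        exact abs_eq_zero.1 this
      simp [hz]
    · have : ContinuousAt (fun ε : ℝ => ((∑ i, |z i| ^ p) + ε) ^ (2 / p - 1)) 0 :=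
        ContinuousAt.rpow_const (by fun_prop) (Or.inl (by simpa using hS))
      have h := this.tendsto
      rw [add_zero] at h
      exact (h.mono_left nhdsWithin_le_nhds).mul_const _
  refine le_of_tendsto_of_tendsto (c1 _) (((c1 _).add (c2.const_mul 2)).add_const _) ?_
  filter_upwards [self_mem_nhdsWithin] with ε hε
  exact smooth_eps p hp z u ε hε

lemma lpNorm_nonneg' {d : ℕ} (p : ℝ) (x : Fin d → ℝ) : 0 ≤ lpNorm p x := by
  unfold lpNorm; positivity

lemma lpNorm_rpow {d : ℕ} (p r : ℝ) (x : Fin d → ℝ) :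
    lpNorm p x ^ r = (∑ i, |x i| ^ p) ^ (r / p) := by
  unfold lpNorm
  rw [← Real.rpow_mul (by positivity)]
  congr 1; ring

lemma lpNorm_sq {d : ℕ} (p : ℝ) (x : Fin d → ℝ) :
    lpNorm p x ^ 2 = (∑ i, |x i| ^ p) ^ (2 / p) := by
  rw [← lpNorm_rpow, Real.rpow_two]

lemma lpNorm_self {d : ℕ} (p : ℝ) (hp : 0 < p) (x : Fin d → ℝ) :
    lpNorm p x ^ p = ∑ i, |x i| ^ p := by
  rw [lpNorm_rpow, div_self hp.ne', Real.rpow_one]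

lemma lpNorm_eq_zero' {d : ℕ} (p : ℝ) (hp : 0 < p) (x : Fin d → ℝ) (h : lpNorm p x = 0) :
    ∀ i, x i = 0 := by
  intro i
  have h1 := lpNorm_self p hp x
  rw [h, Real.zero_rpow hp.ne'] at h1
  have := (Finset.sum_eq_zero_iff_of_nonneg (fun i _ => by positivity)).1 h1.symm i (Finset.mem_univ i)
  rw [Real.rpow_eq_zero (abs_nonneg _) hp.ne'] at this
  exact abs_eq_zero.1 this

lemma sgnPow_eq {d : ℕ} (p : ℝ) (x : Fin d → ℝ) (i : Fin d) :
    sgnPow (p - 1) x i = |x i| ^ (p - 2) * x i := by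
  unfold sgnPow
  rcases lt_trichotomy (x i) 0 with h | h | h
  · rw [Real.sign_of_neg h, abs_of_neg h, show p - 1 = p - 2 + 1 by ring,
      Real.rpow_add_one (by linarith)]; ring
  · simp [h]
  · rw [Real.sign_of_pos h, abs_of_pos h, show p - 1 = p - 2 + 1 by ring,
      Real.rpow_add_one (by linarith)]; ring

lemma smooth_main {d : ℕ} (p : ℝ) (hp : 2 ≤ p) (z u : Fin d → ℝ) :
    lpNorm p (fun i => z i + u i) ^ 2 ≤ lpNorm p z ^ 2
      + 2 * (∑ i, lpNorm p z ^ (2 - p) * sgnPow (p - 1) z i * u i)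
      + (p - 1) * lpNorm p u ^ 2 := by
  have hp0 : p ≠ 0 := by linarith
  have := smooth_zero p hp z u
  simp only [lpNorm_sq, lpNorm_rpow, sgnPow_eq]
  rw [show (2 - p) / p = 2 / p - 1 by field_simp]
  rw [Finset.mul_sum] at this
  simp only [mul_assoc] at this ⊢
  exact this

def dualJ {d : ℕ} (q : ℝ) (x : Fin d → ℝ) : Fin d → ℝ :=
  fun i => lpNorm q x ^ (2 - q) * sgnPow (q - 1) x i

lemma abs_sgnPow {d : ℕ} (q : ℝ) (hq : 1 < q) (x : Fin d → ℝ) (i : Fin d) :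
    |sgnPow (q - 1) x i| = |x i| ^ (q - 1) := by
  unfold sgnPow
  rcases lt_trichotomy (x i) 0 with h | h | h
  · rw [Real.sign_of_neg h, abs_mul, abs_of_nonneg (Real.rpow_nonneg (abs_nonneg _) _)]; simp
  · rw [h]; simp [Real.zero_rpow (by linarith : q - 1 ≠ 0)]
  · rw [Real.sign_of_pos h, abs_mul, abs_of_nonneg (Real.rpow_nonneg (abs_nonneg _) _)]; simp

lemma abs_dualJ {d : ℕ} (q : ℝ) (hq : 1 < q) (x : Fin d → ℝ) (i : Fin d) :
    |dualJ q x i| = lpNorm q x ^ (2 - q) * |x i| ^ (q - 1) := by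
  unfold dualJ
  rw [abs_mul, abs_sgnPow q hq, abs_of_nonneg (Real.rpow_nonneg (lpNorm_nonneg' _ _) _)]

lemma dualJ_inner {d : ℕ} (q : ℝ) (hq : 1 < q) (x : Fin d → ℝ) :
    ∑ i, dualJ q x i * x i = lpNorm q x ^ 2 := by
  have hq0 : 0 < q := by linarith
  have h1 : ∀ i, dualJ q x i * x i = lpNorm q x ^ (2 - q) * |x i| ^ q := by
    intro i
    unfold dualJ
    rw [sgnPow_eq, mul_assoc, mul_assoc]
    congr 1
    by_cases h : x i = 0
    · simp [h, Real.zero_rpow hq0.ne']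
    · rw [← sq, ← sq_abs, ← Real.rpow_two, ← Real.rpow_add (by positivity)]
      congr 1; ring
  simp only [h1]
  rw [← Finset.mul_sum, ← lpNorm_self q hq0]
  by_cases h : lpNorm q x = 0
  · simp [h, Real.zero_rpow hq0.ne']
  · have := (lpNorm_nonneg' q x).lt_of_ne' h
    rw [← Real.rpow_add this, ← Real.rpow_two]
    congr 1; ring

lemma dualJ_norm {d : ℕ} (p q : ℝ) (hq : 1 < q) (hp : 1 < p) (h : p * (q - 1) = q)
    (x : Fin d → ℝ) : lpNorm p (dualJ q x) = lpNorm q x := by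
  have hp0 : 0 < p := by linarith
  have hq0 : 0 < q := by linarith
  have h1 : ∑ i, |dualJ q x i| ^ p = lpNorm q x ^ p := by
    have : ∀ i, |dualJ q x i| ^ p = lpNorm q x ^ ((2 - q) * p) * |x i| ^ q := by
      intro i
      rw [abs_dualJ q hq, Real.mul_rpow (Real.rpow_nonneg (lpNorm_nonneg' _ _) _)
        (Real.rpow_nonneg (abs_nonneg _) _), ← Real.rpow_mul (lpNorm_nonneg' _ _),
        ← Real.rpow_mul (abs_nonneg _), mul_comm (q - 1), h]
    simp only [this]
    rw [← Finset.mul_sum, ← lpNorm_self q hq0]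
    by_cases h0 : lpNorm q x = 0
    · simp [h0, Real.zero_rpow hq0.ne', Real.zero_rpow hp0.ne']
    · have := (lpNorm_nonneg' q x).lt_of_ne' h0
      rw [← Real.rpow_add this]
      congr 1; nlinarith
  have : lpNorm p (dualJ q x) = (∑ i, |dualJ q x i| ^ p) ^ (1 / p) := rfl
  rw [this, h1, ← Real.rpow_mul (lpNorm_nonneg' _ _), mul_one_div_cancel hp0.ne', Real.rpow_one]

lemma dualJ_dualJ {d : ℕ} (p q : ℝ) (hq : 1 < q) (hp : 1 < p) (h : p * (q - 1) = q)
    (x : Fin d → ℝ) (i : Fin d) : dualJ p (dualJ q x) i = x i := by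
  have hq0 : 0 < q := by linarith
  by_cases hx : x i = 0
  · have : dualJ q x i = 0 := by unfold dualJ; rw [sgnPow_eq, hx]; simp
    rw [dualJ, sgnPow_eq, this, hx]; simp
  · have hn : 0 < lpNorm q x := by
      refine (lpNorm_nonneg' q x).lt_of_ne' fun h0 => hx (lpNorm_eq_zero' q hq0 x h0 i)
    have hax : 0 < |x i| := abs_pos.2 hx
    rw [dualJ, dualJ_norm p q hq hp h, sgnPow_eq, abs_dualJ q hq,
      Real.mul_rpow (by positivity) (by positivity), ← Real.rpow_mul hn.le, ← Real.rpow_mul hax.le,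
      dualJ, sgnPow_eq]
    have e1 : lpNorm q x ^ (2 - p) * lpNorm q x ^ ((2 - q) * (p - 2)) * lpNorm q x ^ (2 - q) = 1 := by
      rw [← Real.rpow_add hn, ← Real.rpow_add hn]
      rw [show 2 - p + (2 - q) * (p - 2) + (2 - q) = 0 by nlinarith, Real.rpow_zero]
    have e2 : |x i| ^ ((q - 1) * (p - 2)) * |x i| ^ (q - 2) = 1 := by
      rw [← Real.rpow_add hax]
      rw [show (q - 1) * (p - 2) + (q - 2) = 0 by nlinarith, Real.rpow_zero]
    calc _ = (lpNorm q x ^ (2 - p) * lpNorm q x ^ ((2 - q) * (p - 2)) * lpNorm q x ^ (2 - q)) *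
          (|x i| ^ ((q - 1) * (p - 2)) * |x i| ^ (q - 2)) * x i := by ring
      _ = x i := by rw [e1, e2]; ring

lemma lpNorm_smul' {d : ℕ} (p : ℝ) (hp : 0 < p) (c : ℝ) (hc : 0 ≤ c) (x : Fin d → ℝ) :
    lpNorm p (fun i => c * x i) = c * lpNorm p x := by
  unfold lpNorm
  simp only [abs_mul, abs_of_nonneg hc, Real.mul_rpow hc (abs_nonneg _)]
  rw [← Finset.mul_sum, Real.mul_rpow (by positivity) (by positivity), ← Real.rpow_mul hc,
    mul_one_div_cancel hp.ne', Real.rpow_one]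

lemma convex_main {d : ℕ} (p q : ℝ) (hp : 2 ≤ p) (hq : 1 < q) (hpq : 1 / p + 1 / q = 1)
    (w v : Fin d → ℝ) :
    lpNorm q w ^ 2 + 2 * (∑ i, dualJ q w i * (v i - w i)) + (q - 1) * lpNorm q (v - w) ^ 2
      ≤ lpNorm q v ^ 2 := by
  have hp0 : 0 < p := by linarith
  have hq0 : 0 < q := by linarith
  have h : p * (q - 1) = q := by
    field_simp at hpq; linarith
  have hp1 : 1 < p := by linarith
  set u : Fin d → ℝ := fun i => (q - 1) * dualJ q (v - w) i with hu
  set z := dualJ q w with hz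
  have hc : p.HolderConjugate q := by
    rw [Real.holderConjugate_iff]; exact ⟨hp1, by simpa using hpq⟩
  have b1 := Real.inner_le_Lp_mul_Lq Finset.univ (fun i => z i + u i) v hc
  change _ ≤ lpNorm p (fun i => z i + u i) * lpNorm q v at b1
  have b2 := smooth_main p hp z u
  have b3 : ∑ i, lpNorm p z ^ (2 - p) * sgnPow (p - 1) z i * u i = ∑ i, w i * u i :=
    Finset.sum_congr rfl fun i _ => by
      have := dualJ_dualJ p q hq hp1 h w i
      rw [dualJ] at this
      rw [this]
  have b4 : lpNorm p z = lpNorm q w := dualJ_norm p q hq hp1 h w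
  have b5 : lpNorm p u = (q - 1) * lpNorm q (v - w) := by
    rw [hu, lpNorm_smul' p hp0 _ (by linarith), dualJ_norm p q hq hp1 h]
  have b6 : ∑ i, z i * w i = lpNorm q w ^ 2 := dualJ_inner q hq w
  have b7 : ∑ i, u i * v i - ∑ i, w i * u i = (q - 1) * lpNorm q (v - w) ^ 2 := by
    rw [← dualJ_inner q hq (v - w), Finset.mul_sum, ← Finset.sum_sub_distrib]
    exact Finset.sum_congr rfl fun i _ => by simp only [hu, Pi.sub_apply]; ring
  have b8 : ∑ i, (z i + u i) * v i = ∑ i, z i * v i + ∑ i, u i * v i := by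
    simp only [add_mul, Finset.sum_add_distrib]
  have b9 : ∑ i, z i * (v i - w i) = ∑ i, z i * v i - ∑ i, z i * w i := by
    simp only [mul_sub, Finset.sum_sub_distrib]
  rw [b3, b4, b5] at b2
  have b10 : (p - 1) * ((q - 1) * lpNorm q (v - w)) ^ 2 = (q - 1) * lpNorm q (v - w) ^ 2 := by
    have : (p - 1) * (q - 1) = 1 := by linarith
    calc _ = ((p - 1) * (q - 1)) * ((q - 1) * lpNorm q (v - w) ^ 2) := by ring
      _ = _ := by rw [this, one_mul]
  rw [b10] at b2
  rw [b8] at b1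
  rw [b9]
  nlinarith [sq_nonneg (lpNorm p (fun i => z i + u i) - lpNorm q v)]

/-- for conjugate exponents `2 ≤ p`, `1 < q ≤ 2`,
`h(w) = ‖w‖_q²/(2(q−1))` is 1-strongly convex w.r.t. `‖·‖_q` and its Fenchel
conjugate `h*(z) = ‖z‖_p²/(2(p−1))` is 1-smooth w.r.t. `‖·‖_p`, where the
gradients are given by the explicit mirror-map formulas. -/
theorem stmt0 (d : ℕ) (hd : 1 ≤ d) (p q : ℝ) (hp : 2 ≤ p)
    (hq1 : 1 < q) (hq2 : q ≤ 2) (hpq : 1 / p + 1 / q = 1)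
    (h : (Fin d → ℝ) → ℝ) (hdef : ∀ w, h w = lpNorm q w ^ 2 / (2 * (q - 1)))
    (hstar : (Fin d → ℝ) → ℝ)
    (hstardef : ∀ z, hstar z = lpNorm p z ^ 2 / (2 * (p - 1)))
    (gradh : (Fin d → ℝ) → Fin d → ℝ)
    (gradhdef : ∀ w i, gradh w i = (1 / (q - 1)) * lpNorm q w ^ (2 - q) * sgnPow (q - 1) w i)
    (gradhstar : (Fin d → ℝ) → Fin d → ℝ)
    (gradhstardef : ∀ z i,
      gradhstar z i = (1 / (p - 1)) * lpNorm p z ^ (2 - p) * sgnPow (p - 1) z i) :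
    (∀ w v : Fin d → ℝ,
      h w + (∑ i, gradh w i * (v i - w i)) + (1 / 2) * lpNorm q (v - w) ^ 2 ≤ h v)
    ∧
    (∀ z z' : Fin d → ℝ,
      hstar z' ≤ hstar z + (∑ i, gradhstar z i * (z' i - z i))
        + (1 / 2) * lpNorm p (z' - z) ^ 2) := by

  constructor
  · intro w v
    have := convex_main p q hp hq1 hpq w v
    have hc : 0 < q - 1 := by linarith
    have e : ∑ i, gradh w i * (v i - w i) = (1 / (q - 1)) * ∑ i, dualJ q w i * (v i - w i) := by
      rw [Finset.mul_sum]
      exact Finset.sum_congr rfl fun i _ => by rw [gradhdef, dualJ]; ring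
    rw [e, hdef, hdef, le_div_iff₀ (by positivity)]
    refine le_trans (le_of_eq ?_) this
    field_simp
  · intro z z'
    have := smooth_main p hp z (z' - z)
    have e0 : (fun i => z i + (z' - z) i) = z' := by ext i; simp
    rw [e0] at this
    have hc : 0 < p - 1 := by linarith
    have e : ∑ i, gradhstar z i * (z' i - z i) = (1 / (p - 1)) *
        ∑ i, lpNorm p z ^ (2 - p) * sgnPow (p - 1) z i * (z' - z) i := by
      rw [Finset.mul_sum]
      exact Finset.sum_congr rfl fun i _ => by rw [gradhstardef, Pi.sub_apply]; ring
    rw [e, hstardef, hstardef, div_le_iff₀ (by positivity)]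
    refine le_trans this (le_of_eq ?_)
    field_simp
end
end

section
/- There exists a universal constant C > 0 (independent of d, p, n and the probability space) with the following property. Let (Ω, 𝓕, P) be a probability space with a filtration (𝓕_i)_{i≥0}, let d, n ≥ 1, let p ≥ 2 be a real number, and let v_1, …, v_n be ℝ^d-valued random vectors such that v_i is 𝓕_i-measurable, E[v_i | 𝓕_{i−1}] = 0, and E|[v_i]_j|^p < ∞ for every i ∈ [n], j ∈ [d]. Then E sup_{1 ≤ m ≤ n} ‖∑_{i=1}^m v_i‖_p² ≤ C² d^{2/p} p³ n · sup_{i∈[n], j∈[d]} ( E|[v_i]_j|^p )^{2/p}. -/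
noncomputable section

open Real MeasureTheory

lemma tangent_pos {q x y : ℝ} (hq : 1 ≤ q) (hx : 0 ≤ x) (hy : 0 ≤ y) :
    x ^ q + q * x ^ (q - 1) * (y - x) ≤ y ^ q := by
  rcases hx.eq_or_lt with h | h
  · subst h
    rcases hq.eq_or_lt with h1 | h1
    · subst h1; simp
    · rw [Real.zero_rpow (by linarith), Real.zero_rpow (by linarith)]
      simp; positivity
  · have hb := one_add_mul_self_le_rpow_one_add (s := y / x - 1) (p := q)
      (by have : 0 ≤ y / x := by positivity
          linarith) hq
    have e : (1 + (y / x - 1)) = y / x := by ring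
    rw [e, Real.div_rpow hy h.le, le_div_iff₀ (by positivity)] at hb
    refine le_trans (le_of_eq ?_) hb
    rw [Real.rpow_sub_one h.ne']
    field_simp

lemma abs_rpow_mul_sq {r b : ℝ} (hb : b ≠ 0) : |b| ^ (r - 2) * b * b = |b| ^ (r - 1) * |b| := by
  have hb' : 0 < |b| := abs_pos.mpr hb
  have : |b| ^ (r - 1) = |b| ^ (r - 2) * |b| := by
    rw [← Real.rpow_add_one hb'.ne']; ring_nf
  rw [this, mul_assoc, mul_assoc, abs_mul_abs_self]

lemma tangent_abs {r : ℝ} (hr : 1 ≤ r) (a b : ℝ) :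
    |b| ^ r + r * (|b| ^ (r - 2) * b) * (a - b) ≤ |a| ^ r := by
  by_cases hb : b = 0
  · subst hb
    simp [Real.zero_rpow (by linarith : r ≠ 0)]; positivity
  have h := tangent_pos hr (abs_nonneg b) (abs_nonneg a)
  have hb' : 0 < |b| := abs_pos.mpr hb
  have e1 : |b| ^ (r - 1) = |b| ^ (r - 2) * |b| := by
    rw [← Real.rpow_add_one hb'.ne']; ring_nf
  have h2 : |b| ^ (r - 2) * (b * a) ≤ |b| ^ (r - 2) * (|b| * |a|) := by
    rw [← abs_mul]
    exact mul_le_mul_of_nonneg_left (le_abs_self _) (by positivity)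
  have h3 := abs_rpow_mul_sq (r := r) hb
  rw [e1] at h h3
  have h4 : r * (|b| ^ (r - 2) * (b * a)) ≤ r * (|b| ^ (r - 2) * (|b| * |a|)) :=
    mul_le_mul_of_nonneg_left h2 (by linarith)
  nlinarith

lemma gdiff_aux {p m x y : ℝ} (hp : 2 ≤ p) (hx : 0 ≤ x) (hy : 0 ≤ y) (hxy : y ≤ x) (hxm : x ≤ m) :
    (x ^ (p - 2) * x - y ^ (p - 2) * y) * (x - y) ≤ p * (m ^ (p - 2) * (x - y) ^ 2) := by
  have key : ∀ z : ℝ, 0 ≤ z → z ^ (p - 2) * z = z ^ (p - 1) := by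
    intro z hz
    rw [← Real.rpow_add_one' hz (by linarith)]; ring_nf
  have h := tangent_pos (q := p - 1) (by linarith) hx hy
  have e : p - 1 - 1 = p - 2 := by ring
  rw [e] at h
  rw [key x hx, key y hy]
  have h1 : x ^ (p - 2) ≤ m ^ (p - 2) := Real.rpow_le_rpow hx hxm (by linarith)
  have h0 : 0 ≤ x ^ (p - 2) := by positivity
  have hd : 0 ≤ x - y := by linarith
  calc _ ≤ ((p - 1) * x ^ (p - 2) * (x - y)) * (x - y) := by
        apply mul_le_mul_of_nonneg_right _ hd; linarith
    _ = (p - 1) * (x ^ (p - 2) * (x - y) ^ 2) := by ring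
    _ ≤ p * (m ^ (p - 2) * (x - y) ^ 2) := by gcongr; linarith

lemma gdiff_pos {p m x y : ℝ} (hp : 2 ≤ p) (hx : 0 ≤ x) (hy : 0 ≤ y) (hxm : x ≤ m) (hym : y ≤ m) :
    (x ^ (p - 2) * x - y ^ (p - 2) * y) * (x - y) ≤ p * (m ^ (p - 2) * (x - y) ^ 2) := by
  rcases le_total y x with h | h
  · exact gdiff_aux hp hx hy h hxm
  · have := gdiff_aux hp hy hx h hym
    nlinarith

lemma gdiff_opp {p m x y : ℝ} (hp : 2 ≤ p) (hx : 0 ≤ x) (hy : 0 ≤ y) (hxm : x ≤ m) (hym : y ≤ m) :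
    (x ^ (p - 2) * x + y ^ (p - 2) * y) * (x + y) ≤ p * (m ^ (p - 2) * (x + y) ^ 2) := by
  have h1 : x ^ (p - 2) ≤ m ^ (p - 2) := Real.rpow_le_rpow hx hxm (by linarith)
  have h2 : y ^ (p - 2) ≤ m ^ (p - 2) := Real.rpow_le_rpow hy hym (by linarith)
  have hm : 0 ≤ m := hx.trans hxm
  have h0 : 0 ≤ m ^ (p - 2) := by positivity
  calc _ ≤ (m ^ (p - 2) * x + m ^ (p - 2) * y) * (x + y) := by gcongr
    _ = 1 * (m ^ (p - 2) * (x + y) ^ 2) := by ring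
    _ ≤ _ := by gcongr; linarith

lemma gdiff {p m a b : ℝ} (hp : 2 ≤ p) (ha : |a| ≤ m) (hb : |b| ≤ m) :
    (|a| ^ (p - 2) * a - |b| ^ (p - 2) * b) * (a - b) ≤ p * (m ^ (p - 2) * (a - b) ^ 2) := by
  rcases le_total 0 a with h | h <;> rcases le_total 0 b with h' | h'
  · rw [abs_of_nonneg h] at *; rw [abs_of_nonneg h'] at *
    exact gdiff_pos hp h h' ha hb
  · rw [abs_of_nonneg h] at *; rw [abs_of_nonpos h'] at *
    have := gdiff_opp hp h (neg_nonneg.mpr h') ha hb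
    convert this using 1 <;> ring
  · rw [abs_of_nonpos h] at *; rw [abs_of_nonneg h'] at *
    have := gdiff_opp hp (neg_nonneg.mpr h) h' ha hb
    convert this using 1 <;> ring
  · rw [abs_of_nonpos h] at *; rw [abs_of_nonpos h'] at *
    have := gdiff_pos hp (neg_nonneg.mpr h) (neg_nonneg.mpr h') ha hb
    convert this using 1 <;> ring

lemma smooth_ineq {p : ℝ} (hp : 2 ≤ p) (s v : ℝ) :
    |s + v| ^ p ≤ |s| ^ p + p * (|s| ^ (p - 2) * s) * v
      + p ^ 2 * ((|s| + |v|) ^ (p - 2) * v ^ 2) := by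
  have h1 := tangent_abs (r := p) (by linarith) s (s + v)
  have h2 := gdiff (p := p) (m := |s| + |v|) (a := s + v) (b := s) hp (abs_add_le s v)
    (by linarith [abs_nonneg v])
  have e : s + v - s = v := by ring
  have e' : s - (s + v) = -v := by ring
  rw [e] at h2
  rw [e'] at h1
  have h3 := mul_le_mul_of_nonneg_left h2 (by linarith : 0 ≤ p)
  nlinarith

lemma holder_pt {p a b : ℝ} (hp : 2 ≤ p) (ha : 0 < a) (hb : 0 < b) :
    ∃ α β : ℝ, 0 ≤ α ∧ 0 ≤ β ∧ α + β = 1 ∧ ∀ s v : ℝ, 0 ≤ s → 0 ≤ v →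
      (s + v) ^ (p - 2) * v ^ 2 ≤
        ((a + b) ^ (p - 2) * b ^ 2) * (α * (s ^ p / a ^ p) + β * (v ^ p / b ^ p)) := by
  have hp0 : 0 < p := by linarith
  refine ⟨(p - 2) / p * (a / (a + b)), (p - 2) / p * (b / (a + b)) + 2 / p, ?_, ?_, ?_, ?_⟩
  · have : 0 ≤ p - 2 := by linarith
    positivity
  · have : 0 ≤ p - 2 := by linarith
    positivity
  · field_simp; ring
  intro s v hs hv
  have hab : 0 < a + b := by linarith
  have hp2 : 0 ≤ (p - 2) / p := div_nonneg (by linarith) hp0.le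
  have h1 := Real.geom_mean_le_arith_mean2_weighted (w₁ := (p - 2) / p) (w₂ := 2 / p)
    (p₁ := ((s + v) / (a + b)) ^ p) (p₂ := (v / b) ^ p) hp2
    (by positivity) (by positivity) (by positivity) (by field_simp; ring)
  rw [← Real.rpow_mul (by positivity), ← Real.rpow_mul (by positivity)] at h1
  rw [show p * ((p - 2) / p) = p - 2 by field_simp, show p * (2 / p) = (2 : ℕ) by
    push_cast; field_simp, Real.rpow_natCast] at h1
  have hc := convexOn_rpow (p := p) (by linarith)
  have hsa : s / a ∈ Set.Ici (0 : ℝ) := div_nonneg hs ha.le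
  have hvb : v / b ∈ Set.Ici (0 : ℝ) := div_nonneg hv hb.le
  have hw1 : 0 ≤ a / (a + b) := by positivity
  have hw2 : 0 ≤ b / (a + b) := by positivity
  have h2 := hc.2 hsa hvb hw1 hw2 (by field_simp)
  simp only [smul_eq_mul] at h2
  rw [show a / (a + b) * (s / a) + b / (a + b) * (v / b) = (s + v) / (a + b) by field_simp] at h2
  have h3 : ((s + v) / (a + b)) ^ (p - 2) * (v / b) ^ 2 ≤
      (p - 2) / p * (a / (a + b) * (s / a) ^ p + b / (a + b) * (v / b) ^ p)
        + 2 / p * (v / b) ^ p := by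
    refine h1.trans ?_
    gcongr
  rw [Real.div_rpow (by positivity) hab.le, Real.div_rpow hs ha.le, Real.div_rpow hv hb.le] at h3
  have hA : 0 < (a + b) ^ (p - 2) := by positivity
  calc (s + v) ^ (p - 2) * v ^ 2
      = ((a + b) ^ (p - 2) * b ^ 2) * ((s + v) ^ (p - 2) / (a + b) ^ (p - 2) * (v / b) ^ 2) := by
        field_simp
    _ ≤ _ := mul_le_mul_of_nonneg_left h3 (by positivity)
    _ = _ := by ring

/-- numeric recursion step -/
lemma num_step {p : ℝ} (hp : 2 ≤ p) (k : ℕ) :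
    (√(3 * p ^ 2 * (k + 1))) ^ p + p ^ 2 * (√(3 * p ^ 2 * (k + 1)) + 1) ^ (p - 2)
      ≤ (√(3 * p ^ 2 * (k + 1 + 1))) ^ p := by
  have hp0 : 0 < p := by linarith
  set x : ℝ := 3 * p ^ 2 * (k + 1) with hx
  have hxp : p ^ 2 ≤ x := by
    have : (0:ℝ) ≤ k := by positivity
    nlinarith [sq_nonneg p]
  have hx0 : 0 < x := by positivity
  have hy : 3 * p ^ 2 * ((k:ℝ) + 1 + 1) = x + 3 * p ^ 2 := by rw [hx]; ring
  rw [hy]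
  have hs : ∀ z : ℝ, 0 ≤ z → (√z) ^ p = z ^ (p / 2) := by
    intro z hz
    rw [Real.sqrt_eq_rpow, ← Real.rpow_mul hz]; ring_nf
  have h := tangent_pos (q := p / 2) (x := x) (y := x + 3 * p ^ 2) (by linarith) hx0.le (by positivity)
  rw [hs _ hx0.le, hs _ (by positivity)]
  refine le_trans ?_ h
  have hpx : p ≤ √x := Real.le_sqrt_of_sq_le hxp
  have hsx : 0 < √x := by linarith
  have h1 : √x + 1 ≤ √x * Real.exp (1 / p) := by
    have := Real.add_one_le_exp (1 / p)
    have h2 : √x * (1 / p + 1) ≤ √x * Real.exp (1 / p) := by gcongr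
    have h3 : 1 ≤ √x * (1 / p) := by rw [mul_one_div, le_div_iff₀ hp0]; linarith
    nlinarith
  have h2 : (√x + 1) ^ (p - 2) ≤ x ^ (p / 2 - 1) * 3 := by
    calc (√x + 1) ^ (p - 2) ≤ (√x * Real.exp (1 / p)) ^ (p - 2) :=
          Real.rpow_le_rpow (by positivity) h1 (by linarith)
      _ = x ^ (p / 2 - 1) * Real.exp (1 / p * (p - 2)) := by
          rw [Real.mul_rpow (by positivity) (by positivity), ← Real.exp_mul, Real.sqrt_eq_rpow,
            ← Real.rpow_mul hx0.le]
          ring_nf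
      _ ≤ x ^ (p / 2 - 1) * 3 := by
          gcongr
          have : 1 / p * (p - 2) ≤ 1 := by
            rw [one_div, inv_mul_le_iff₀ hp0]; linarith
          calc Real.exp (1 / p * (p - 2)) ≤ Real.exp 1 := Real.exp_le_exp.mpr this
            _ ≤ 3 := by have := Real.exp_one_lt_d9; linarith
  have h3 : 0 ≤ x ^ (p / 2 - 1) := by positivity
  have h4 : p ^ 2 * (√x + 1) ^ (p - 2) ≤ p ^ 2 * (x ^ (p / 2 - 1) * 3) := by gcongr
  have h5 : p ^ 2 * (x ^ (p / 2 - 1) * 3) ≤ p / 2 * x ^ (p / 2 - 1) * (x + 3 * p ^ 2 - x) := by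
    have : p ^ 2 * 3 ≤ p / 2 * (3 * p ^ 2) := by nlinarith [sq_nonneg p]
    calc p ^ 2 * (x ^ (p / 2 - 1) * 3) = (p ^ 2 * 3) * x ^ (p / 2 - 1) := by ring
      _ ≤ (p / 2 * (3 * p ^ 2)) * x ^ (p / 2 - 1) := by gcongr
      _ = _ := by ring
  linarith

/-- partial sums -/
def pS {Ω : Type} (u : ℕ → Ω → ℝ) (k : ℕ) (ω : Ω) : ℝ := ∑ i ∈ Finset.range k, u i ω

/-- partial sums of absolute values -/
def pT {Ω : Type} (u : ℕ → Ω → ℝ) (k : ℕ) (ω : Ω) : ℝ := ∑ i ∈ Finset.range k, |u i ω|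

/-- running maximum of the `r`-th powers of the partial sums -/
def pM {Ω : Type} (r : ℝ) (u : ℕ → Ω → ℝ) : ℕ → Ω → ℝ
  | 0, _ => 0
  | k + 1, ω => max (pM r u k ω) (|pS u (k + 1) ω| ^ r)

lemma pS_succ {Ω : Type} (u : ℕ → Ω → ℝ) (k : ℕ) (ω : Ω) :
    pS u (k + 1) ω = pS u k ω + u k ω := Finset.sum_range_succ _ _

lemma pT_succ {Ω : Type} (u : ℕ → Ω → ℝ) (k : ℕ) (ω : Ω) :
    pT u (k + 1) ω = pT u k ω + |u k ω| := Finset.sum_range_succ _ _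

lemma pT_nonneg {Ω : Type} (u : ℕ → Ω → ℝ) (k : ℕ) (ω : Ω) : 0 ≤ pT u k ω :=
  Finset.sum_nonneg fun _ _ => abs_nonneg _

lemma pS_le {Ω : Type} (u : ℕ → Ω → ℝ) (k : ℕ) (ω : Ω) : |pS u k ω| ≤ pT u k ω :=
  Finset.abs_sum_le_sum_abs _ _

lemma pT_mono {Ω : Type} (u : ℕ → Ω → ℝ) (k : ℕ) (ω : Ω) : pT u k ω ≤ pT u (k + 1) ω := by
  rw [pT_succ]; linarith [abs_nonneg (u k ω)]

lemma pM_nonneg {Ω : Type} (r : ℝ) (u : ℕ → Ω → ℝ) (k : ℕ) (ω : Ω) : 0 ≤ pM r u k ω := by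
  cases k with
  | zero => simp [pM]
  | succ k => exact le_max_of_le_right (by positivity)

lemma pM_le {Ω : Type} {r : ℝ} (hr : 0 ≤ r) (u : ℕ → Ω → ℝ) (k : ℕ) (ω : Ω) :
    pM r u k ω ≤ (pT u k ω) ^ r := by
  induction k with
  | zero => simp only [pM]; exact Real.rpow_nonneg (pT_nonneg _ _ _) _
  | succ k ih =>
    refine max_le (ih.trans ?_) ?_
    · exact Real.rpow_le_rpow (pT_nonneg _ _ _) (pT_mono _ _ _) hr
    · exact Real.rpow_le_rpow (abs_nonneg _) (pS_le _ _ _) hr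

lemma le_pM {Ω : Type} (r : ℝ) (u : ℕ → Ω → ℝ) (n m : ℕ) (hm : 1 ≤ m) (hmn : m ≤ n) (ω : Ω) :
    |pS u m ω| ^ r ≤ pM r u n ω := by
  induction n, hmn using Nat.le_induction with
  | base =>
    obtain ⟨k, rfl⟩ := Nat.exists_eq_add_of_le' hm
    exact le_max_right _ _
  | succ n _ ih => exact ih.trans (le_max_left _ _)

lemma doob_path {Ω : Type} {r : ℝ} (hr : 1 ≤ r) (u : ℕ → Ω → ℝ) (n : ℕ) (ω : Ω) :
    pM r u n ω ^ 2 ≤ 2 * pM r u n ω * |pS u n ω| ^ r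
      - 2 * ∑ k ∈ Finset.range n,
        pM r u k ω * (r * (|pS u k ω| ^ (r - 2) * pS u k ω)) * u k ω := by
  induction n with
  | zero => simp [pM]
  | succ n ih =>
    rw [Finset.sum_range_succ]
    have ht := tangent_abs hr (pS u (n + 1) ω) (pS u n ω)
    rw [show pS u (n + 1) ω - pS u n ω = u n ω by rw [pS_succ]; ring] at ht
    have hm := pM_nonneg r u n ω
    have ht2 := mul_le_mul_of_nonneg_left ht hm
    simp only [pM]
    set x := |pS u (n + 1) ω| ^ r
    set m := pM r u n ω
    rcases le_total m x with h | h
    · rw [max_eq_right h]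
      nlinarith [sq_nonneg (x - m)]
    · rw [max_eq_left h]
      nlinarith

lemma meas_abs' {Ω : Type} {m : MeasurableSpace Ω} {f : Ω → ℝ} (hf : Measurable[m] f) :
    Measurable[m] (fun ω => |f ω|) := continuous_abs.measurable.comp hf

lemma meas_abs_pow {Ω : Type} {m : MeasurableSpace Ω} {f : Ω → ℝ} (hf : Measurable[m] f) (r : ℝ) :
    Measurable[m] (fun ω => |f ω| ^ r) := (meas_abs' hf).pow_const r

lemma meas_grad {Ω : Type} {m : MeasurableSpace Ω} {f : Ω → ℝ} (hf : Measurable[m] f) (c r : ℝ) :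
    Measurable[m] (fun ω => c * (|f ω| ^ r * f ω)) := ((meas_abs_pow hf r).mul hf).const_mul c

lemma meas_mul_grad {Ω : Type} {m : MeasurableSpace Ω} {f g : Ω → ℝ} (hg : Measurable[m] g)
    (hf : Measurable[m] f) (c r : ℝ) :
    Measurable[m] (fun ω => g ω * (c * (|f ω| ^ r * f ω))) := hg.mul (meas_grad hf c r)

section
variable {Ω : Type} {mΩ : MeasurableSpace Ω} {P : Measure Ω} [IsProbabilityMeasure P]

lemma orth {m : MeasurableSpace Ω} (hm : m ≤ mΩ) {g u : Ω → ℝ} (hg : Measurable[m] g)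
    (hgu : Integrable (fun ω => g ω * u ω) P) (hu : Integrable u P) (h0 : P[u | m] =ᵐ[P] 0) :
    ∫ ω, g ω * u ω ∂P = 0 := by
  have h := condExp_mul_of_stronglyMeasurable_left (μ := P) (m := m) (f := g) (g := u)
    hg.stronglyMeasurable hgu hu
  rw [← integral_condExp hm]
  rw [show (fun ω => g ω * u ω) = g * u from rfl, integral_congr_ae h]
  apply integral_eq_zero_of_ae
  filter_upwards [h0] with ω hω
  simp [hω]

variable {𝓕 : ℕ → MeasurableSpace Ω} {u : ℕ → Ω → ℝ} {p : ℝ}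

lemma pS_meas (hmono : ∀ i j, i ≤ j → 𝓕 i ≤ 𝓕 j)
    (hu : ∀ k, Measurable[𝓕 (k + 1)] (u k)) (k : ℕ) : Measurable[𝓕 k] (pS u k) := by
  unfold pS
  refine Finset.measurable_fun_sum _ fun i hi => ?_
  exact (hu i).mono (hmono _ _ (by simpa using hi)) le_rfl

lemma pM_meas (r : ℝ) (hmono : ∀ i j, i ≤ j → 𝓕 i ≤ 𝓕 j)
    (hu : ∀ k, Measurable[𝓕 (k + 1)] (u k)) (k : ℕ) : Measurable[𝓕 k] (pM r u k) := by
  induction k with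
  | zero => exact measurable_const
  | succ k ih =>
    exact (ih.mono (hmono _ _ (Nat.le_succ k)) le_rfl).max
      (meas_abs_pow (pS_meas hmono hu (k + 1)) r)

lemma pT_int (hp : 2 ≤ p) (hu : ∀ k, Measurable (u k))
    (hint : ∀ k, Integrable (fun ω => |u k ω| ^ p) P) (k : ℕ) :
    Integrable (fun ω => pT u k ω ^ p) P := by
  have hp0 : 0 < p := by linarith
  have hL : ∀ i, MemLp (fun ω => |u i ω|) (ENNReal.ofReal p) P := by
    intro i
    have := (integrable_norm_rpow_iff (μ := P) (f := fun ω => |u i ω|) (p := ENNReal.ofReal p)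
      (hu i).abs.aestronglyMeasurable (by simpa using hp0) (by simp)).1
    apply this
    simpa [ENNReal.toReal_ofReal hp0.le] using hint i
  have hS : MemLp (pT u k) (ENNReal.ofReal p) P := memLp_finsetSum _ fun i _ => hL i
  have := hS.integrable_norm_rpow (by simpa using hp0) (by simp)
  refine this.congr (Filter.Eventually.of_forall fun ω => ?_)
  simp [ENNReal.toReal_ofReal hp0.le, abs_of_nonneg (pT_nonneg u k ω)]

lemma u_int (hp : 2 ≤ p) (hu : ∀ k, Measurable (u k))
    (hint : ∀ k, Integrable (fun ω => |u k ω| ^ p) P) (k : ℕ) : Integrable (u k) P := by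
  refine Integrable.mono' ((integrable_const (1 : ℝ)).add (hint k))
    (hu k).aestronglyMeasurable (Filter.Eventually.of_forall fun ω => ?_)
  simp only [Real.norm_eq_abs, Pi.add_apply]
  rcases le_total (|u k ω|) 1 with h | h
  · have : 0 ≤ |u k ω| ^ p := by positivity
    linarith
  · have := Real.rpow_le_rpow_of_exponent_le h (by linarith : 1 ≤ p)
    rw [Real.rpow_one] at this
    linarith

lemma rpow_sub_mul_le {r t s : ℝ} (hr : 1 ≤ r) (hs : |s| ≤ t) :
    |(|s| ^ (r - 2) * s)| ≤ t ^ (r - 1) := by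
  by_cases h : s = 0
  · subst h
    have : 0 ≤ t := by simpa using hs
    simp; positivity
  · have h' : 0 < |s| := abs_pos.mpr h
    rw [abs_mul, abs_of_nonneg (by positivity : 0 ≤ |s| ^ (r - 2)), ← Real.rpow_add_one h'.ne']
    rw [show r - 2 + 1 = r - 1 by ring]
    exact Real.rpow_le_rpow h'.le hs (by linarith)

/-- all adapted product terms are integrable with zero mean -/
lemma term_zero (hle : ∀ i, 𝓕 i ≤ mΩ) (hp : 2 ≤ p)
    (hu : ∀ k, Measurable[𝓕 (k + 1)] (u k)) (h0 : ∀ k, P[u k | 𝓕 k] =ᵐ[P] 0)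
    (hint : ∀ k, Integrable (fun ω => |u k ω| ^ p) P) (k : ℕ) (g : Ω → ℝ) (c : ℝ)
    (hg : Measurable[𝓕 k] g) (hgb : ∀ ω, |g ω| ≤ c * pT u k ω ^ (p - 1)) (hc : 0 ≤ c) :
    Integrable (fun ω => g ω * u k ω) P ∧ ∫ ω, g ω * u k ω ∂P = 0 := by
  have hu' : ∀ k, Measurable (u k) := fun k => (hu k).mono (hle _) le_rfl
  have hI : Integrable (fun ω => g ω * u k ω) P := by
    refine Integrable.mono' ((pT_int hp hu' hint (k + 1)).const_mul c)
      ((hg.mono (hle _) le_rfl).mul (hu' k)).aestronglyMeasurable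
      (Filter.Eventually.of_forall fun ω => ?_)
    rw [Real.norm_eq_abs, abs_mul]
    have hT := pT_nonneg u k ω
    have hT1 := pT_nonneg u (k + 1) ω
    calc |g ω| * |u k ω| ≤ (c * pT u (k + 1) ω ^ (p - 1)) * pT u (k + 1) ω := by
          gcongr
          · exact (hgb ω).trans (mul_le_mul_of_nonneg_left
              (Real.rpow_le_rpow hT (pT_mono _ _ _) (by linarith)) hc)
          · rw [pT_succ]; linarith
      _ = c * pT u (k + 1) ω ^ p := by
          rw [mul_assoc, ← Real.rpow_add_one' hT1 (by linarith)]; ring_nf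
  exact ⟨hI, orth (hle k) hg hI (u_int hp hu' hint k) (h0 k)⟩

lemma pS_int (hp : 2 ≤ p) (hu : ∀ k, Measurable (u k))
    (hint : ∀ k, Integrable (fun ω => |u k ω| ^ p) P) (k : ℕ) :
    Integrable (fun ω => |pS u k ω| ^ p) P := by
  have hm : Measurable (pS u k) := Finset.measurable_fun_sum _ fun i _ => hu i
  refine Integrable.mono' (pT_int hp hu hint k) (hm.abs.pow_const p).aestronglyMeasurable
    (Filter.Eventually.of_forall fun ω => ?_)
  rw [Real.norm_eq_abs, abs_of_nonneg (by positivity)]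
  exact Real.rpow_le_rpow (abs_nonneg _) (pS_le _ _ _) (by linarith)

/-- one step of the moment recursion -/
lemma moment_step (hmono : ∀ i j, i ≤ j → 𝓕 i ≤ 𝓕 j) (hle : ∀ i, 𝓕 i ≤ mΩ) (hp : 2 ≤ p)
    (hu : ∀ k, Measurable[𝓕 (k + 1)] (u k)) (h0 : ∀ k, P[u k | 𝓕 k] =ᵐ[P] 0)
    (hint : ∀ k, Integrable (fun ω => |u k ω| ^ p) P) (k : ℕ) {a b : ℝ} (ha : 0 < a) (hb : 0 < b)
    (hA : ∫ ω, |pS u k ω| ^ p ∂P ≤ a ^ p) (hB : ∫ ω, |u k ω| ^ p ∂P ≤ b ^ p) :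
    ∫ ω, |pS u (k + 1) ω| ^ p ∂P ≤ a ^ p + p ^ 2 * ((a + b) ^ (p - 2) * b ^ 2) := by
  have hu' : ∀ k, Measurable (u k) := fun k => (hu k).mono (hle _) le_rfl
  obtain ⟨α, β, hα, hβ, hαβ, hH⟩ := holder_pt hp ha hb
  have hSm := pS_meas hmono hu k
  obtain ⟨hI, hz⟩ := term_zero hle hp hu h0 hint k
    (fun ω => p * (|pS u k ω| ^ (p - 2) * pS u k ω)) p
    (meas_grad hSm p (p - 2))
    (fun ω => by
      rw [abs_mul, abs_of_nonneg (by linarith : 0 ≤ p)]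
      exact mul_le_mul_of_nonneg_left (rpow_sub_mul_le (by linarith) (pS_le u k ω)) (by linarith))
    (by linarith)
  set K := (a + b) ^ (p - 2) * b ^ 2 with hK
  have hK0 : 0 ≤ K := by positivity
  have hSi := pS_int hp hu' hint k
  have hJ : Integrable (fun ω => p ^ 2 * (K * (α * (|pS u k ω| ^ p / a ^ p)
      + β * (|u k ω| ^ p / b ^ p)))) P :=
    ((((hSi.div_const _).const_mul α).add (((hint k).div_const _).const_mul β)).const_mul K).const_mul _
  calc ∫ ω, |pS u (k + 1) ω| ^ p ∂P
      ≤ ∫ ω, ((|pS u k ω| ^ p + p * (|pS u k ω| ^ (p - 2) * pS u k ω) * u k ω)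
        + p ^ 2 * (K * (α * (|pS u k ω| ^ p / a ^ p) + β * (|u k ω| ^ p / b ^ p)))) ∂P := by
        refine integral_mono (pS_int hp hu' hint (k + 1)) ((hSi.add hI).add hJ) fun ω => ?_
        have h1 := smooth_ineq hp (pS u k ω) (u k ω)
        have h2 := hH _ _ (abs_nonneg (pS u k ω)) (abs_nonneg (u k ω))
        rw [sq_abs] at h2
        have h3 := mul_le_mul_of_nonneg_left h2 (sq_nonneg p)
        simp only [pS_succ]
        linarith
    _ = ∫ ω, |pS u k ω| ^ p ∂P + p ^ 2 * (K * (α * ((∫ ω, |pS u k ω| ^ p ∂P) / a ^ p)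
        + β * ((∫ ω, |u k ω| ^ p ∂P) / b ^ p))) := by
        have hSI : Integrable (fun ω => |pS u k ω| ^ p
            + p * (|pS u k ω| ^ (p - 2) * pS u k ω) * u k ω) P := hSi.add hI
        rw [integral_add hSI hJ, integral_add hSi hI, hz, add_zero,
          integral_const_mul, integral_const_mul,
          integral_add ((hSi.div_const _).const_mul α) (((hint k).div_const _).const_mul β),
          integral_const_mul, integral_const_mul, integral_div, integral_div]
    _ ≤ a ^ p + p ^ 2 * (K * (α * 1 + β * 1)) := by
        gcongr
        · rw [div_le_one (by positivity)]; exact hA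
        · rw [div_le_one (by positivity)]; exact hB
    _ = _ := by rw [mul_one, mul_one, hαβ, mul_one]

lemma moment_bound (hmono : ∀ i j, i ≤ j → 𝓕 i ≤ 𝓕 j) (hle : ∀ i, 𝓕 i ≤ mΩ) (hp : 2 ≤ p)
    (hu : ∀ k, Measurable[𝓕 (k + 1)] (u k)) (h0 : ∀ k, P[u k | 𝓕 k] =ᵐ[P] 0)
    (hint : ∀ k, Integrable (fun ω => |u k ω| ^ p) P) {σ : ℝ} (hσ : 0 < σ)
    (hB : ∀ k, ∫ ω, |u k ω| ^ p ∂P ≤ σ ^ p) (k : ℕ) :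
    ∫ ω, |pS u k ω| ^ p ∂P ≤ (√(3 * p ^ 2 * (k + 1)) * σ) ^ p := by
  induction k with
  | zero =>
    simp only [pS, Finset.range_zero, Finset.sum_empty, abs_zero]
    rw [Real.zero_rpow (by linarith)]
    simp only [integral_zero]
    positivity
  | succ k ih =>
    have hp0 : 0 < p := by linarith
    have h := moment_step hmono hle hp hu h0 hint k (by positivity) hσ ih (hB k)
    refine h.trans ?_
    have hn := num_step hp k
    push_cast
    rw [Real.mul_rpow (by positivity) hσ.le, Real.mul_rpow (by positivity) hσ.le]
    set x := √(3 * p ^ 2 * (k + 1))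
    rw [show x * σ + σ = (x + 1) * σ by ring, Real.mul_rpow (by positivity) hσ.le]
    have e : σ ^ (p - 2) * σ ^ 2 = σ ^ p := by
      rw [← Real.rpow_natCast, ← Real.rpow_add hσ]; norm_num
    have := mul_le_mul_of_nonneg_right hn (by positivity : 0 ≤ σ ^ p)
    calc _ = (x ^ p + p ^ 2 * (x + 1) ^ (p - 2)) * σ ^ p := by rw [← e]; ring
      _ ≤ _ := this

lemma doob_bound (hmono : ∀ i j, i ≤ j → 𝓕 i ≤ 𝓕 j) (hle : ∀ i, 𝓕 i ≤ mΩ) (hp : 2 ≤ p)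
    (hu : ∀ k, Measurable[𝓕 (k + 1)] (u k)) (h0 : ∀ k, P[u k | 𝓕 k] =ᵐ[P] 0)
    (hint : ∀ k, Integrable (fun ω => |u k ω| ^ p) P) (n : ℕ) :
    Integrable (fun ω => pM (p / 2) u n ω ^ 2) P ∧
    ∫ ω, pM (p / 2) u n ω ^ 2 ∂P ≤ 4 * ∫ ω, |pS u n ω| ^ p ∂P := by
  have hu' : ∀ k, Measurable (u k) := fun k => (hu k).mono (hle _) le_rfl
  have hsq : ∀ x : ℝ, 0 ≤ x → (x ^ (p / 2)) ^ 2 = x ^ p := by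
    intro x hx
    rw [← Real.rpow_natCast, ← Real.rpow_mul hx]; norm_num
  have hI : Integrable (fun ω => pM (p / 2) u n ω ^ 2) P := by
    refine Integrable.mono' (pT_int hp hu' hint n)
      (((pM_meas (p / 2) hmono hu n).mono (hle _) le_rfl).pow_const 2).aestronglyMeasurable
      (Filter.Eventually.of_forall fun ω => ?_)
    rw [Real.norm_eq_abs, abs_of_nonneg (by positivity), ← hsq _ (pT_nonneg _ _ _)]
    exact pow_le_pow_left₀ (pM_nonneg _ _ _ _) (pM_le (by linarith) _ _ _) 2
  refine ⟨hI, ?_⟩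
  have ht : ∀ k, Integrable (fun ω => pM (p / 2) u k ω *
      (p / 2 * (|pS u k ω| ^ (p / 2 - 2) * pS u k ω)) * u k ω) P ∧
      ∫ ω, pM (p / 2) u k ω *
      (p / 2 * (|pS u k ω| ^ (p / 2 - 2) * pS u k ω)) * u k ω ∂P = 0 := by
    intro k
    have hSm := pS_meas hmono hu k
    refine term_zero hle hp hu h0 hint k _ (p / 2)
      (meas_mul_grad (pM_meas (p / 2) hmono hu k) hSm (p / 2) (p / 2 - 2))
      (fun ω => ?_) (by linarith)
    have hT := pT_nonneg u k ω
    rw [abs_mul, abs_mul, abs_of_nonneg (by linarith : 0 ≤ p / 2),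
      abs_of_nonneg (pM_nonneg _ _ _ _)]
    calc _ ≤ pT u k ω ^ (p / 2) * (p / 2 * pT u k ω ^ (p / 2 - 1)) := by
          gcongr
          · exact pM_le (by linarith) _ _ _
          · exact rpow_sub_mul_le (by linarith) (pS_le u k ω)
      _ = p / 2 * (pT u k ω ^ (p / 2) * pT u k ω ^ (p / 2 - 1)) := by ring
      _ = p / 2 * pT u k ω ^ (p - 1) := by
          rw [← Real.rpow_add' hT (by linarith)]; ring_nf
  have hSi := pS_int hp hu' hint n
  have hsumI := integrable_finsetSum (μ := P) (Finset.range n) (fun k _ => (ht k).1)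
  calc ∫ ω, pM (p / 2) u n ω ^ 2 ∂P
      ≤ ∫ ω, (4 * |pS u n ω| ^ p - 4 * ∑ k ∈ Finset.range n, pM (p / 2) u k ω *
      (p / 2 * (|pS u k ω| ^ (p / 2 - 2) * pS u k ω)) * u k ω) ∂P := by
        refine integral_mono hI ((hSi.const_mul 4).sub (hsumI.const_mul 4)) fun ω => ?_
        have h := doob_path (r := p / 2) (by linarith) u n ω
        have h2 := hsq _ (abs_nonneg (pS u n ω))
        simp only
        rw [← h2]
        nlinarith [sq_nonneg (pM (p / 2) u n ω - 2 * |pS u n ω| ^ (p / 2))]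
    _ = _ := by
        rw [integral_sub (hSi.const_mul 4) (hsumI.const_mul 4), integral_const_mul,
          integral_const_mul, integral_finsetSum _ (fun k _ => (ht k).1),
          Finset.sum_eq_zero (fun k _ => (ht k).2)]
        simp
end

/-- concavity bound -/
lemma concave_pt {θ z B : ℝ} (h0 : 0 ≤ θ) (h1 : θ ≤ 1) (hz : 0 ≤ z) (hB : 0 < B) :
    z ^ θ ≤ B ^ θ * (θ * (z / B) + (1 - θ)) := by
  have h := Real.geom_mean_le_arith_mean2_weighted (w₁ := θ) (w₂ := 1 - θ) (p₁ := z / B) (p₂ := 1)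
    h0 (by linarith) (by positivity) (by norm_num) (by ring)
  rw [Real.one_rpow, mul_one, mul_one, Real.div_rpow hz hB.le] at h
  calc z ^ θ = B ^ θ * (z ^ θ / B ^ θ) := by field_simp
    _ ≤ _ := mul_le_mul_of_nonneg_left h (by positivity)

lemma vec_bound {Ω : Type} {mΩ : MeasurableSpace Ω} {P : Measure Ω} [IsProbabilityMeasure P]
    {𝓕 : ℕ → MeasurableSpace Ω} {p : ℝ} {d : ℕ} (hd : 1 ≤ d) {u : Fin d → ℕ → Ω → ℝ}
    (hmono : ∀ i j, i ≤ j → 𝓕 i ≤ 𝓕 j) (hle : ∀ i, 𝓕 i ≤ mΩ) (hp : 2 ≤ p)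
    (hu : ∀ j k, Measurable[𝓕 (k + 1)] (u j k)) (h0 : ∀ j k, P[u j k | 𝓕 k] =ᵐ[P] 0)
    (hint : ∀ j k, Integrable (fun ω => |u j k ω| ^ p) P) {σ : ℝ} (hσ : 0 < σ)
    (hB : ∀ j k, ∫ ω, |u j k ω| ^ p ∂P ≤ σ ^ p) (n : ℕ) (hn : 1 ≤ n) :
    ∫⁻ ω, ENNReal.ofReal ((∑ j, pM (p / 2) (u j) n ω ^ 2) ^ (2 / p)) ∂P
      ≤ ENNReal.ofReal (25 * (d : ℝ) ^ (2 / p) * p ^ 3 * n * σ ^ 2) := by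
  have hp0 : 0 < p := by linarith
  have hd0 : (0 : ℝ) < d := by exact_mod_cast hd
  have hn1 : (1 : ℝ) ≤ n := by exact_mod_cast hn
  set B : ℝ := d * (4 * (√(6 * p ^ 2 * n) * σ) ^ p) with hBdef
  have hBpos : 0 < B := by positivity
  have hθ0 : 0 ≤ 2 / p := by positivity
  have hθ1 : 2 / p ≤ 1 := by rw [div_le_one hp0]; exact hp
  have hj : ∀ j, Integrable (fun ω => pM (p / 2) (u j) n ω ^ 2) P :=
    fun j => (doob_bound hmono hle hp (hu j) (h0 j) (hint j) n).1
  have hjb : ∀ j, ∫ ω, pM (p / 2) (u j) n ω ^ 2 ∂P ≤ 4 * (√(6 * p ^ 2 * n) * σ) ^ p := by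
    intro j
    refine (doob_bound hmono hle hp (hu j) (h0 j) (hint j) n).2.trans ?_
    have := moment_bound hmono hle hp (hu j) (h0 j) (hint j) hσ (hB j) n
    have h2 : (√(3 * p ^ 2 * (n + 1)) * σ) ^ p ≤ (√(6 * p ^ 2 * n) * σ) ^ p := by
      apply Real.rpow_le_rpow (by positivity) _ hp0.le
      gcongr ?_ * σ
      apply Real.sqrt_le_sqrt
      nlinarith [sq_nonneg p]
    linarith
  have hZ : Integrable (fun ω => ∑ j, pM (p / 2) (u j) n ω ^ 2) P :=
    integrable_finsetSum _ fun j _ => hj j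
  have hZb : ∫ ω, ∑ j, pM (p / 2) (u j) n ω ^ 2 ∂P ≤ B := by
    rw [integral_finsetSum _ fun j _ => hj j]
    calc _ ≤ ∑ _j : Fin d, 4 * (√(6 * p ^ 2 * n) * σ) ^ p := Finset.sum_le_sum fun j _ => hjb j
      _ = B := by simp [hBdef]
  have hZ0 : ∀ ω, 0 ≤ ∑ j, pM (p / 2) (u j) n ω ^ 2 :=
    fun ω => Finset.sum_nonneg fun _ _ => sq_nonneg _
  have hR : Integrable (fun ω => B ^ (2 / p) *
      (2 / p * ((∑ j, pM (p / 2) (u j) n ω ^ 2) / B) + (1 - 2 / p))) P :=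
    (((hZ.div_const B).const_mul _).add (integrable_const _)).const_mul _
  have hRi : ∫ ω, B ^ (2 / p) *
      (2 / p * ((∑ j, pM (p / 2) (u j) n ω ^ 2) / B) + (1 - 2 / p)) ∂P ≤ B ^ (2 / p) := by
    rw [integral_const_mul, integral_add ((hZ.div_const B).const_mul _) (integrable_const _),
      integral_const_mul, integral_div, integral_const]
    simp only [probReal_univ, one_smul]
    have : (∫ ω, ∑ j, pM (p / 2) (u j) n ω ^ 2 ∂P) / B ≤ 1 := by
      rw [div_le_one hBpos]; exact hZb
    have h1 : 2 / p * ((∫ ω, ∑ j, pM (p / 2) (u j) n ω ^ 2 ∂P) / B) ≤ 2 / p * 1 := by gcongr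
    calc _ ≤ B ^ (2 / p) * 1 := by
          apply mul_le_mul_of_nonneg_left _ (by positivity)
          linarith
      _ = _ := mul_one _
  have hBθ : B ^ (2 / p) ≤ 25 * (d : ℝ) ^ (2 / p) * p ^ 3 * n * σ ^ 2 := by
    rw [hBdef, Real.mul_rpow hd0.le (by positivity), Real.mul_rpow (by norm_num) (by positivity),
      ← Real.rpow_mul (by positivity), show p * (2 / p) = (2 : ℕ) by push_cast; field_simp,
      Real.rpow_natCast, mul_pow, Real.sq_sqrt (by positivity)]
    have h4 : (4 : ℝ) ^ (2 / p) ≤ 4 := by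
      calc (4 : ℝ) ^ (2 / p) ≤ 4 ^ (1 : ℝ) :=
            Real.rpow_le_rpow_of_exponent_le (by norm_num) hθ1
        _ = 4 := Real.rpow_one _
    have h5 : 4 * (6 * p ^ 2) ≤ 25 * p ^ 3 := by nlinarith [sq_nonneg p]
    calc (d : ℝ) ^ (2 / p) * (4 ^ (2 / p) * (6 * p ^ 2 * n * σ ^ 2))
        ≤ (d : ℝ) ^ (2 / p) * (4 * (6 * p ^ 2 * n * σ ^ 2)) := by gcongr
      _ = (d : ℝ) ^ (2 / p) * n * σ ^ 2 * (4 * (6 * p ^ 2)) := by ring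
      _ ≤ (d : ℝ) ^ (2 / p) * n * σ ^ 2 * (25 * p ^ 3) := by gcongr
      _ = _ := by ring
  calc _ ≤ ∫⁻ ω, ENNReal.ofReal (B ^ (2 / p) *
      (2 / p * ((∑ j, pM (p / 2) (u j) n ω ^ 2) / B) + (1 - 2 / p))) ∂P :=
        lintegral_mono fun ω => ENNReal.ofReal_le_ofReal (concave_pt hθ0 hθ1 (hZ0 ω) hBpos)
    _ = ENNReal.ofReal (∫ ω, B ^ (2 / p) *
      (2 / p * ((∑ j, pM (p / 2) (u j) n ω ^ 2) / B) + (1 - 2 / p)) ∂P) := by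
        rw [ofReal_integral_eq_lintegral_ofReal hR]
        refine Filter.Eventually.of_forall fun ω => ?_
        exact le_trans (Real.rpow_nonneg (hZ0 ω) _) (concave_pt hθ0 hθ1 (hZ0 ω) hBpos)
    _ ≤ _ := ENNReal.ofReal_le_ofReal (hRi.trans hBθ)

/-- a Burkholder–Davis–Gundy type moment bound.  There is a
universal constant `C > 0` such that for any martingale difference sequence
`v_1, …, v_n` in ℝ^d with coordinatewise finite `p`-th moments (`p ≥ 2`),
`E sup_{1≤m≤n} ‖∑_{i≤m} v_i‖_p² ≤ C² d^{2/p} p³ n · sup_{i,j} (E|[v_i]_j|^p)^{2/p}`. -/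
theorem stmt2 :
    ∃ C : ℝ, 0 < C ∧
      ∀ (Ω : Type) (mΩ : MeasurableSpace Ω) (P : Measure Ω)
        (_hP : IsProbabilityMeasure P)
        (𝓕 : ℕ → MeasurableSpace Ω)
        (_hmono : ∀ i j, i ≤ j → 𝓕 i ≤ 𝓕 j) (_hle : ∀ i, 𝓕 i ≤ mΩ)
        (d n : ℕ) (hd : 1 ≤ d) (hn : 1 ≤ n)
        (p : ℝ) (_hp : 2 ≤ p)
        (v : ℕ → Ω → Fin d → ℝ)
        (_hmeas : ∀ i, 1 ≤ i → i ≤ n → Measurable[𝓕 i] (v i))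
        (_hzero : ∀ i (j : Fin d), 1 ≤ i → i ≤ n →
          P[fun ω => v i ω j | 𝓕 (i - 1)] =ᵐ[P] 0)
        (_hmom : ∀ i (j : Fin d), 1 ≤ i → i ≤ n →
          Integrable (fun ω => |v i ω j| ^ p) P),
      ∫⁻ ω, ENNReal.ofReal
          ((Finset.Icc 1 n).sup' (Finset.nonempty_Icc.mpr hn)
            (fun m => lpNorm p (∑ i ∈ Finset.Icc 1 m, v i ω) ^ 2)) ∂P
        ≤ ENNReal.ofReal (C ^ 2 * (d : ℝ) ^ ((2 : ℝ) / p) * p ^ 3 * n *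
            ((Finset.Icc 1 n).sup' (Finset.nonempty_Icc.mpr hn) fun i =>
              (Finset.univ : Finset (Fin d)).sup'
                ⟨⟨0, by omega⟩, Finset.mem_univ _⟩ fun j =>
                  (∫ ω, |v i ω j| ^ p ∂P) ^ ((2 : ℝ) / p))) := by
  refine ⟨5, by norm_num, ?_⟩
  intro Ω mΩ P hP 𝓕 hmono hle d n hd hn p hp v hmeas hzero hmom
  have hp0 : 0 < p := by linarith
  set R : ℝ := ((Finset.Icc 1 n).sup' (Finset.nonempty_Icc.mpr hn) fun i =>
              (Finset.univ : Finset (Fin d)).sup'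
                ⟨⟨0, by omega⟩, Finset.mem_univ _⟩ fun j =>
                  (∫ ω, |v i ω j| ^ p ∂P) ^ ((2 : ℝ) / p)) with hR
  have hRle : ∀ i (j : Fin d), 1 ≤ i → i ≤ n → (∫ ω, |v i ω j| ^ p ∂P) ^ ((2 : ℝ) / p) ≤ R := by
    intro i j h1 h2
    refine le_trans ?_ (Finset.le_sup' _ (Finset.mem_Icc.mpr ⟨h1, h2⟩))
    exact Finset.le_sup' (fun j => (∫ ω, |v i ω j| ^ p ∂P) ^ ((2 : ℝ) / p)) (Finset.mem_univ j)
  have hint0 : ∀ i j, 0 ≤ ∫ ω, |v i ω j| ^ p ∂P :=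
    fun i j => integral_nonneg fun ω => by positivity
  have hR0 : 0 ≤ R := (Real.rpow_nonneg (hint0 1 ⟨0, by omega⟩) _).trans
    (hRle 1 ⟨0, by omega⟩ le_rfl hn)
  set u : Fin d → ℕ → Ω → ℝ := fun j k ω => if k < n then v (k + 1) ω j else 0 with hudef
  have hu1 : ∀ j k, k < n → u j k = fun ω => v (k + 1) ω j := by
    intro j k hk; funext ω; simp [hudef, hk]
  have hu2 : ∀ j k, ¬ k < n → u j k = fun _ => 0 := by
    intro j k hk; funext ω; simp [hudef, hk]
  have hS : ∀ j m ω, m ≤ n → pS (u j) m ω = (∑ i ∈ Finset.Icc 1 m, v i ω) j := by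
    intro j m ω hm
    rw [Finset.sum_apply]
    induction m with
    | zero => simp [pS]
    | succ m ih =>
      rw [pS_succ, ih (by omega), Finset.sum_Icc_succ_top (by omega), hu1 j m (by omega)]
  have hpt : ∀ ω, ((Finset.Icc 1 n).sup' (Finset.nonempty_Icc.mpr hn)
            (fun m => lpNorm p (∑ i ∈ Finset.Icc 1 m, v i ω) ^ 2))
        ≤ (∑ j, pM (p / 2) (u j) n ω ^ 2) ^ (2 / p) := by
    intro ω
    refine Finset.sup'_le _ _ fun m hm => ?_
    rw [Finset.mem_Icc] at hm
    have hnn : 0 ≤ ∑ j, |(∑ i ∈ Finset.Icc 1 m, v i ω) j| ^ p :=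
      Finset.sum_nonneg fun j _ => by positivity
    rw [_root_.lpNorm, ← Real.rpow_natCast, ← Real.rpow_mul hnn,
      show 1 / p * ((2 : ℕ) : ℝ) = 2 / p by push_cast; ring]
    refine Real.rpow_le_rpow hnn (Finset.sum_le_sum fun j _ => ?_) (by positivity)
    rw [← hS j m ω hm.2]
    have h := le_pM (p / 2) (u j) n m hm.1 hm.2 ω
    have h2 := pow_le_pow_left₀ (by positivity) h 2
    rw [← Real.rpow_natCast, ← Real.rpow_mul (abs_nonneg _)] at h2
    norm_num at h2
    exact h2
  have hmain : ∀ σ : ℝ, √R < σ →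
      ∫⁻ ω, ENNReal.ofReal
          ((Finset.Icc 1 n).sup' (Finset.nonempty_Icc.mpr hn)
            (fun m => lpNorm p (∑ i ∈ Finset.Icc 1 m, v i ω) ^ 2)) ∂P
        ≤ ENNReal.ofReal (25 * (d : ℝ) ^ (2 / p) * p ^ 3 * n * σ ^ 2) := by
    intro σ hσ
    have hσ0 : 0 < σ := (Real.sqrt_nonneg R).trans_lt hσ
    refine (lintegral_mono fun ω => ENNReal.ofReal_le_ofReal (hpt ω)).trans ?_
    refine vec_bound hd hmono hle hp ?_ ?_ ?_ hσ0 ?_ n hn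
    · intro j k
      by_cases hk : k < n
      · rw [hu1 j k hk]
        exact (measurable_pi_apply j).comp (hmeas (k + 1) (by omega) (by omega))
      · rw [hu2 j k hk]; exact measurable_const
    · intro j k
      by_cases hk : k < n
      · rw [hu1 j k hk]
        simpa using hzero (k + 1) j (by omega) (by omega)
      · rw [hu2 j k hk]
        have : P[(fun _ => 0 : Ω → ℝ) | 𝓕 k] = 0 := condExp_zero
        rw [this]
    · intro j k
      by_cases hk : k < n
      · rw [hu1 j k hk]
        exact hmom (k + 1) j (by omega) (by omega)
      · rw [hu2 j k hk]; exact integrable_const _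
    · intro j k
      by_cases hk : k < n
      · rw [hu1 j k hk]
        have h := hRle (k + 1) j (by omega) (by omega)
        have h2 : R ≤ σ ^ 2 := (Real.sqrt_le_left hσ0.le).mp hσ.le
        have h3 := Real.rpow_le_rpow (Real.rpow_nonneg (hint0 _ _) _) (h.trans h2)
          (by linarith : 0 ≤ p / 2)
        rw [← Real.rpow_mul (hint0 _ _), show 2 / p * (p / 2) = 1 by field_simp, Real.rpow_one,
          ← Real.rpow_natCast, ← Real.rpow_mul hσ0.le] at h3
        rw [show ((2 : ℕ) : ℝ) * (p / 2) = p by push_cast; ring] at h3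
        exact h3
      · rw [hu2 j k hk]
        simp only [abs_zero, Real.zero_rpow hp0.ne', integral_zero]
        positivity
  have hlim : Filter.Tendsto
      (fun σ : ℝ => ENNReal.ofReal (25 * (d : ℝ) ^ (2 / p) * p ^ 3 * n * σ ^ 2))
      (nhdsWithin (√R) (Set.Ioi (√R)))
      (nhds (ENNReal.ofReal (25 * (d : ℝ) ^ (2 / p) * p ^ 3 * n * (√R) ^ 2))) := by
    apply Filter.Tendsto.mono_left _ nhdsWithin_le_nhds
    exact (ENNReal.continuous_ofReal.comp (by fun_prop :
      Continuous fun σ : ℝ => 25 * (d : ℝ) ^ (2 / p) * p ^ 3 * n * σ ^ 2)).tendsto _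
  have hfin := ge_of_tendsto hlim (Filter.eventually_of_mem self_mem_nhdsWithin hmain)
  rw [Real.sq_sqrt hR0] at hfin
  refine hfin.trans (le_of_eq ?_)
  norm_num
end
end

section
/- Let K ≥ 1 be an integer, let a, b, η > 0, and let (s_r)_{r=0}^{K−1} be a sequence of nonnegative reals with s_0 = 0 satisfying s_{r+1} ≤ (1 + a r η²) s_r + b for all r = 0, …, K−2. If √a · K · η ≤ 1, then s_{K−1} ≤ e · K · b, where e is Euler's number. -/
noncomputable section

open Real

/-- a recursion-to-bound lemma.  If a nonnegative sequence
satisfies `s_0 = 0` and `s_{r+1} ≤ (1 + a r η²) s_r + b` for `r = 0,…,K−2`,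
and `√a · K · η ≤ 1`, then `s_{K−1} ≤ e K b`. -/
theorem stmt5 (K : ℕ) (hK : 1 ≤ K) (a b η : ℝ)
    (ha : 0 < a) (hb : 0 < b) (hη : 0 < η)
    (s : ℕ → ℝ) (hs : ∀ r, 0 ≤ s r) (hs0 : s 0 = 0)
    (hrec : ∀ r : ℕ, r + 2 ≤ K → s (r + 1) ≤ (1 + a * r * η ^ 2) * s r + b)
    (hstep : Real.sqrt a * K * η ≤ 1) :
    s (K - 1) ≤ Real.exp 1 * K * b := by
  have hKpos : (0 : ℝ) < K := by exact_mod_cast hK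
  have hsq : a * η ^ 2 * (K : ℝ) ^ 2 ≤ 1 := by
    have h0 : 0 ≤ Real.sqrt a * K * η := by positivity
    have h1 : (Real.sqrt a * K * η) ^ 2 ≤ 1 := pow_le_one₀ h0 hstep
    have h2 : Real.sqrt a ^ 2 = a := Real.sq_sqrt ha.le
    calc a * η ^ 2 * (K : ℝ) ^ 2 = (Real.sqrt a * K * η) ^ 2 := by
          rw [mul_pow, mul_pow, h2]; ring
      _ ≤ 1 := h1
  have key : ∀ r : ℕ, r + 1 ≤ K → s r ≤ Real.exp (r * (1 / (K : ℝ))) * r * b := by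
    intro r
    induction r with
    | zero => intro _; simp [hs0]
    | succ r ih =>
      intro hr
      have ih' := ih (by omega)
      have hrK : (r : ℝ) ≤ K := by exact_mod_cast (by omega : r ≤ K)
      have hc : a * r * η ^ 2 ≤ 1 / (K : ℝ) := by
        rw [le_div_iff₀ hKpos]
        calc a * r * η ^ 2 * K ≤ a * K * η ^ 2 * K := by gcongr
          _ = a * η ^ 2 * (K : ℝ) ^ 2 := by ring
          _ ≤ 1 := hsq
      have he : 1 + a * r * η ^ 2 ≤ Real.exp (1 / (K : ℝ)) := by
        have := Real.add_one_le_exp (1 / (K : ℝ))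
        linarith
      have h1 : 1 ≤ Real.exp (((r + 1 : ℕ) : ℝ) * (1 / (K : ℝ))) :=
        Real.one_le_exp (by positivity)
      have hsplit : Real.exp (((r + 1 : ℕ) : ℝ) * (1 / (K : ℝ)))
          = Real.exp (1 / (K : ℝ)) * Real.exp (r * (1 / (K : ℝ))) := by
        rw [← Real.exp_add]; congr 1; push_cast; ring
      have hm : (1 + a * r * η ^ 2) * s r
          ≤ Real.exp (1 / (K : ℝ)) * (Real.exp (r * (1 / (K : ℝ))) * r * b) :=
        mul_le_mul he ih' (hs r) (Real.exp_pos _).le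
      have hb1 : b ≤ Real.exp (((r + 1 : ℕ) : ℝ) * (1 / (K : ℝ))) * b :=
        le_mul_of_one_le_left hb.le h1
      calc s (r + 1) ≤ (1 + a * r * η ^ 2) * s r + b := hrec r hr
        _ ≤ Real.exp (1 / (K : ℝ)) * (Real.exp (r * (1 / (K : ℝ))) * r * b)
            + Real.exp (((r + 1 : ℕ) : ℝ) * (1 / (K : ℝ))) * b := add_le_add hm hb1
        _ = Real.exp (((r + 1 : ℕ) : ℝ) * (1 / (K : ℝ))) * ((r + 1 : ℕ) : ℝ) * b := by
          rw [hsplit]; push_cast; ring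
  have hle : ((K - 1 : ℕ) : ℝ) ≤ K := by exact_mod_cast Nat.sub_le K 1
  refine (key (K - 1) (by omega)).trans ?_
  have hexp : Real.exp (((K - 1 : ℕ) : ℝ) * (1 / (K : ℝ))) ≤ Real.exp 1 := by
    apply Real.exp_le_exp.mpr
    rw [mul_one_div, div_le_one hKpos]
    exact hle
  gcongr
end
end

section
/- Let f : ℝ^d → ℝ be convex and differentiable, and suppose there is L > 0 such that ‖∇f(w) − ∇f(v)‖_∞ ≤ L‖w − v‖_1 for all w, v ∈ ℝ^d. Then for all w, v ∈ ℝ^d, f(w) + ⟨∇f(w), v − w⟩ + (1/(2L))‖∇f(w) − ∇f(v)‖_∞² ≤ f(v). -/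
noncomputable section

open Real
open scoped RealInnerProductSpace

/-- The ℓ_1 norm of a vector in ℝ^d. -/
def l1Norm {d : ℕ} (x : Fin d → ℝ) : ℝ := ∑ i, |x i|

/-- The ℓ_∞ norm of a vector in ℝ^d. -/
def linfNorm {d : ℕ} (x : Fin d → ℝ) : ℝ :=
  if h : (Finset.univ : Finset (Fin d)).Nonempty then
    Finset.univ.sup' h fun i => |x i|
  else 0

theorem hasDerivAt_line {d : ℕ} (f : EuclideanSpace ℝ (Fin d) → ℝ)
    (g : EuclideanSpace ℝ (Fin d) → EuclideanSpace ℝ (Fin d))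
    (hgrad : ∀ w, HasGradientAt f (g w) w) (w p : EuclideanSpace ℝ (Fin d)) (s : ℝ) :
    HasDerivAt (fun s : ℝ => f (w + s • p)) ⟪g (w + s • p), p⟫ s := by
  have h1 : HasDerivAt (fun s : ℝ => w + s • p) p s := by
    simpa using ((hasDerivAt_id s).smul_const p).const_add w
  have h2 := (hgrad (w + s • p)).hasFDerivAt.comp_hasDerivAt s h1
  simp only [InnerProductSpace.toDual_apply_apply] at h2
  exact h2

theorem grad_ineq {d : ℕ} (f : EuclideanSpace ℝ (Fin d) → ℝ)
    (g : EuclideanSpace ℝ (Fin d) → EuclideanSpace ℝ (Fin d))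
    (hconv : ConvexOn ℝ Set.univ f)
    (hgrad : ∀ w, HasGradientAt f (g w) w) (w p : EuclideanSpace ℝ (Fin d)) :
    f w + ⟪g w, p⟫ ≤ f (w + p) := by
  have hc : ConvexOn ℝ Set.univ (fun s : ℝ => f (w + s • p)) := by
    refine ⟨convex_univ, ?_⟩
    intro x _ y _ a b ha hb hab
    have := hconv.2 (Set.mem_univ (w + x • p)) (Set.mem_univ (w + y • p)) ha hb hab
    have e : a • (w + x • p) + b • (w + y • p) = w + (a • x + b • y) • p := by
      have hw : w = (a + b) • w := by rw [hab, one_smul]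
      conv_rhs => rw [hw]
      simp only [smul_eq_mul]
      module
    rw [e] at this
    exact this
  have h := hc.le_slope_of_hasDerivAt (Set.mem_univ 0) (Set.mem_univ 1) zero_lt_one
    (hasDerivAt_line f g hgrad w p 0)
  simp [slope_def_field] at h
  linarith

theorem descent {d : ℕ} (f : EuclideanSpace ℝ (Fin d) → ℝ)
    (g : EuclideanSpace ℝ (Fin d) → EuclideanSpace ℝ (Fin d))
    (hgrad : ∀ w, HasGradientAt f (g w) w) (v p : EuclideanSpace ℝ (Fin d)) (C : ℝ)
    (hC : ∀ s : ℝ, 0 ≤ s → ⟪g (v + s • p), p⟫ ≤ ⟪g v, p⟫ + C * s) :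
    f (v + p) ≤ f v + ⟪g v, p⟫ + C / 2 := by
  have hd : ∀ s : ℝ, HasDerivAt (fun s : ℝ => f (v + s • p) - (s * ⟪g v, p⟫ + C / 2 * s ^ 2))
      (⟪g (v + s • p), p⟫ - (⟪g v, p⟫ + C * s)) s := by
    intro s
    have h2 : HasDerivAt (fun s : ℝ => s * ⟪g v, p⟫ + C / 2 * s ^ 2) (⟪g v, p⟫ + C * s) s := by
      have h3 := ((hasDerivAt_id' s).mul_const ⟪g v, p⟫).add
        ((hasDerivAt_pow 2 s).const_mul (C / 2))
      have h4 : 1 * ⟪g v, p⟫ + C / 2 * (((2 : ℕ) : ℝ) * s ^ (2 - 1)) = ⟪g v, p⟫ + C * s := by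
        norm_num
        ring
      rw [h4] at h3
      exact h3
    exact (hasDerivAt_line f g hgrad v p s).sub h2
  have ha : AntitoneOn (fun s : ℝ => f (v + s • p) - (s * ⟪g v, p⟫ + C / 2 * s ^ 2))
      (Set.Ici 0) := by
    apply antitoneOn_of_deriv_nonpos (convex_Ici 0)
    · exact fun s _ => (hd s).continuousAt.continuousWithinAt
    · exact fun s _ => (hd s).differentiableAt.differentiableWithinAt
    · intro s hs
      rw [interior_Ici] at hs
      rw [(hd s).deriv]
      linarith [hC s (le_of_lt hs)]
  have := ha (show (0:ℝ) ∈ Set.Ici 0 by simp) (show (1:ℝ) ∈ Set.Ici 0 by simp) zero_le_one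
  simp at this
  linarith

theorem le_linfNorm {d : ℕ} (x : Fin d → ℝ) (i : Fin d) : |x i| ≤ linfNorm x := by
  have h : (Finset.univ : Finset (Fin d)).Nonempty := ⟨i, Finset.mem_univ i⟩
  rw [linfNorm, dif_pos h]
  exact Finset.le_sup' (fun i => |x i|) (Finset.mem_univ i)

theorem exists_linfNorm {d : ℕ} (hd : 1 ≤ d) (x : Fin d → ℝ) : ∃ i, linfNorm x = |x i| := by
  have h : (Finset.univ : Finset (Fin d)).Nonempty := ⟨⟨0, hd⟩, Finset.mem_univ _⟩
  rw [linfNorm, dif_pos h]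
  obtain ⟨i, _, hi⟩ := Finset.exists_mem_eq_sup' h (fun i => |x i|)
  exact ⟨i, hi⟩

/-- cocoercivity-type lower bound for convex `L`-smooth functions
(in the ‖·‖_1/‖·‖_∞ pairing): if `f` is convex and differentiable with
`‖∇f(w) − ∇f(v)‖_∞ ≤ L ‖w − v‖_1`, then
`f(w) + ⟨∇f(w), v − w⟩ + (1/(2L))‖∇f(w) − ∇f(v)‖_∞² ≤ f(v)`. -/
theorem stmt7 (d : ℕ) (hd : 1 ≤ d)
    (f : EuclideanSpace ℝ (Fin d) → ℝ)
    (g : EuclideanSpace ℝ (Fin d) → EuclideanSpace ℝ (Fin d))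
    (hconv : ConvexOn ℝ Set.univ f)
    (hgrad : ∀ w, HasGradientAt f (g w) w)
    (L : ℝ) (hL : 0 < L)
    (hsmooth : ∀ w v, linfNorm (fun i => g w i - g v i)
      ≤ L * l1Norm (fun i => w i - v i)) :
    ∀ w v : EuclideanSpace ℝ (Fin d),
      f w + ⟪g w, v - w⟫ + (1 / (2 * L)) * linfNorm (fun i => g w i - g v i) ^ 2
        ≤ f v := by
  intro w v
  obtain ⟨i, hi⟩ := exists_linfNorm hd (fun i => g w i - g v i)
  rw [hi, sq_abs]
  obtain ⟨a, ha⟩ : ∃ a : ℝ, a = (g w i - g v i) / L := ⟨_, rfl⟩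
  have haL : g w i - g v i = L * a := by rw [ha]; field_simp
  have hin : ∀ x : EuclideanSpace ℝ (Fin d), ⟪x, EuclideanSpace.single i a⟫ = a * x i := by
    intro x
    simp [EuclideanSpace.inner_single_right]
  have h1 := grad_ineq f g hconv hgrad w (v - w + EuclideanSpace.single i a)
  have h2 := descent f g hgrad v (EuclideanSpace.single i a) (L * a ^ 2) (by
    intro s hs
    rw [hin, hin]
    have h3 := (le_linfNorm _ i).trans (hsmooth (v + s • EuclideanSpace.single i a) v)
    have h4 : l1Norm (fun j => (v + s • EuclideanSpace.single i a) j - v j) = s * |a| := by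
      simp only [l1Norm]
      rw [Finset.sum_eq_single i]
      · simp [abs_mul, abs_of_nonneg hs]
      · intro j _ hj
        simp [hj]
      · simp
    rw [h4] at h3
    have h5 := mul_le_mul_of_nonneg_left h3 (abs_nonneg a)
    rw [← abs_mul] at h5
    have h6 := (le_abs_self _).trans h5
    have h7 : |a| * (L * (s * |a|)) = L * a ^ 2 * s := by rw [← sq_abs a]; ring
    rw [h7] at h6
    linarith)
  rw [inner_add_right, hin] at h1
  rw [hin] at h2
  have e : w + (v - w + EuclideanSpace.single i a) = v + EuclideanSpace.single i a := by abel
  rw [e] at h1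
  have h8 : 1 / (2 * L) * (g w i - g v i) ^ 2 = L * a ^ 2 / 2 := by
    rw [haL]; field_simp
  have h9 : a * g w i - a * g v i = L * a ^ 2 := by rw [← mul_sub, haL]; ring
  show f w + ⟪g w, v - w⟫ + 1 / (2 * L) * (g w i - g v i) ^ 2 ≤ f v
  rw [h8]
  linarith
end
end

section
/- Let w* ∈ ℝ^d have at most s nonzero coordinates, let w ∈ ℝ^d, and let w_s be any vector obtained from w by keeping s coordinates of w of largest absolute value (breaking ties arbitrarily) and setting all other coordinates to zero. Then ‖w_s − w*‖_1² ≤ 2s‖w_s − w*‖_2² ≤ 8s‖w − w*‖_2². -/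
noncomputable section

open Real

/-- sparsification error bound.  If `wstar` is `s`-sparse and
`ws` keeps `s` coordinates of `w` of largest absolute value (zeroing the
rest), then `‖ws − wstar‖_1² ≤ 2s ‖ws − wstar‖_2² ≤ 8s ‖w − wstar‖_2²`. -/
theorem stmt8 (d s : ℕ) (wstar w ws : Fin d → ℝ)
    (hsparse : (Finset.univ.filter fun i => wstar i ≠ 0).card ≤ s)
    (S : Finset (Fin d)) (hScard : S.card = s)
    (hStop : ∀ i ∈ S, ∀ j ∉ S, |w j| ≤ |w i|)
    (hws : ∀ i, ws i = if i ∈ S then w i else 0) :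
    (∑ i, |ws i - wstar i|) ^ 2 ≤ 2 * s * ∑ i, (ws i - wstar i) ^ 2 ∧
      2 * s * (∑ i, (ws i - wstar i) ^ 2) ≤ 8 * s * ∑ i, (w i - wstar i) ^ 2 := by
  set T : Finset (Fin d) := Finset.univ.filter fun i => wstar i ≠ 0 with hT
  have memT : ∀ i, i ∉ T → wstar i = 0 := by
    intro i hi
    by_contra h
    exact hi (by simp [hT, h])
  constructor
  · have hz : ∀ i, i ∉ S ∪ T → ws i - wstar i = 0 := by
      intro i hi
      rw [Finset.mem_union, not_or] at hi
      rw [hws, if_neg hi.1, memT i hi.2, sub_zero]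
    have h1 : ∑ i ∈ S ∪ T, |ws i - wstar i| = ∑ i, |ws i - wstar i| :=
      Finset.sum_subset (Finset.subset_univ _) (fun i _ hi => by rw [hz i hi, abs_zero])
    have h2 : (∑ i ∈ S ∪ T, |ws i - wstar i|) ^ 2
        ≤ ((S ∪ T).card : ℝ) * ∑ i ∈ S ∪ T, |ws i - wstar i| ^ 2 :=
      sq_sum_le_card_mul_sum_sq
    have h3 : ∑ i ∈ S ∪ T, |ws i - wstar i| ^ 2 ≤ ∑ i, (ws i - wstar i) ^ 2 := by
      simp only [sq_abs]
      exact Finset.sum_le_sum_of_subset_of_nonneg (Finset.subset_univ _)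
        (fun i _ _ => sq_nonneg _)
    have h4 : ((S ∪ T).card : ℝ) ≤ 2 * s := by
      have h := Finset.card_union_le S T
      have h' : (S ∪ T).card ≤ 2 * s := by omega
      exact_mod_cast h'
    rw [← h1]
    refine h2.trans (mul_le_mul h4 h3 (Finset.sum_nonneg fun i _ => sq_nonneg _) (by positivity))
  · rcases S.eq_empty_or_nonempty with hS | hS
    · have h0 : s = 0 := by rw [← hScard, hS, Finset.card_empty]
      simp [h0]
    · obtain ⟨m, hm, hmin⟩ := S.exists_min_image (fun i => |w i|) hS
      have key : ∑ i, (ws i - w i) ^ 2 ≤ ∑ i, (w i - wstar i) ^ 2 := by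
        have hp : ∀ i, (ws i - w i) ^ 2 - (w i - wstar i) ^ 2 ≤
            (if i ∈ T then (w m) ^ 2 else 0) - (if i ∈ S then (w m) ^ 2 else 0) := by
          intro i
          rw [hws]
          by_cases hiS : i ∈ S
          · have := sq_le_sq.2 (hmin i hiS)
            by_cases hiT : i ∈ T
            · simp only [hiS, hiT, if_true]
              nlinarith [sq_nonneg (w i - wstar i)]
            · simp only [hiS, hiT, if_true, if_false, memT i hiT]
              nlinarith
          · have := sq_le_sq.2 (hStop m hm i hiS)
            by_cases hiT : i ∈ T
            · simp only [hiS, hiT, if_true, if_false]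
              nlinarith [sq_nonneg (w i - wstar i)]
            · simp only [hiS, hiT, if_false, memT i hiT]
              nlinarith
        have hsum := Finset.sum_le_sum (s := Finset.univ) fun i _ => hp i
        rw [Finset.sum_sub_distrib, Finset.sum_sub_distrib, Finset.sum_ite_mem,
          Finset.sum_ite_mem, Finset.univ_inter, Finset.univ_inter, Finset.sum_const,
          Finset.sum_const, hScard, nsmul_eq_mul, nsmul_eq_mul] at hsum
        have hc : (T.card : ℝ) ≤ s := by exact_mod_cast hsparse
        nlinarith [mul_le_mul_of_nonneg_right hc (sq_nonneg (w m))]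
      have h5 : ∑ i, (ws i - wstar i) ^ 2 ≤
          2 * ∑ i, (ws i - w i) ^ 2 + 2 * ∑ i, (w i - wstar i) ^ 2 := by
        rw [Finset.mul_sum, Finset.mul_sum, ← Finset.sum_add_distrib]
        refine Finset.sum_le_sum fun i _ => ?_
        nlinarith [sq_nonneg ((ws i - w i) - (w i - wstar i))]
      have h6 : ∑ i, (ws i - wstar i) ^ 2 ≤ 4 * ∑ i, (w i - wstar i) ^ 2 := by linarith
      have h7 := mul_le_mul_of_nonneg_left h6 (by positivity : (0:ℝ) ≤ 2 * s)
      linarith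
end
end

section
/- Let k ∈ ℤ₊, σ > 0, and let g : ℝ → ℝ be a bounded measurable odd function. Define G : ℝ^k → ℝ^k by G(w) := E_{x ∼ N(0, σ² I_k)}[ g(⟨x, w⟩) x ]. Then G(0) = 0, and for every w ≠ 0, G(w) = 2σ [ ∫_0^{+∞} g(tσ‖w‖_2) φ(t) t dt ] · (w/‖w‖_2), where φ(t) = (2π)^{−1/2} exp(−t²/2) is the standard normal density. -/
noncomputable section

open Real MeasureTheory ProbabilityTheory

/-- One-dimensional Gaussian computation for an odd function. -/
lemma oneDim (s : ℝ) (g : ℝ → ℝ) (hmeas : Measurable g)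
    (hodd : ∀ z, g (-z) = -g z) :
    ∫ y, g y * y ∂(gaussianReal 0 (Real.toNNReal (s ^ 2))) =
      2 * s * ∫ t in Set.Ioi (0 : ℝ),
        g (t * s) * ((Real.sqrt (2 * Real.pi))⁻¹ * Real.exp (-t ^ 2 / 2)) * t := by
  have h1 : gaussianReal 0 (Real.toNNReal (s ^ 2)) = (gaussianReal 0 1).map (s * ·) := by
    rw [gaussianReal_map_const_mul]
    congr 1
    · simp
    · ext
      simp [sq_nonneg]
  rw [h1, integral_map (by fun_prop) (by fun_prop),
    integral_gaussianReal_eq_integral_smul (by simp)]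
  rw [mul_comm 2 s, mul_assoc, ← integral_comp_abs
    (f := fun t => g (t * s) * ((Real.sqrt (2 * Real.pi))⁻¹ * Real.exp (-t ^ 2 / 2)) * t),
    ← integral_const_mul]
  congr 1
  ext t
  simp only [gaussianPDFReal, smul_eq_mul]
  rcases abs_cases t with ⟨h, -⟩ | ⟨h, -⟩
  · rw [h]; simp; ring_nf
  · rw [h, neg_mul, hodd]; simp; ring_nf

lemma gauss_id {k : ℕ} (v : NNReal) : HasGaussianLaw (fun x : Fin k → ℝ => x)
      (Measure.pi fun _ => gaussianReal 0 v) := by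
  have hind : iIndepFun (fun (i : Fin k) (x : Fin k → ℝ) => x i)
      (Measure.pi fun _ => gaussianReal 0 v) :=
    iIndepFun_pi (X := fun _ (t : ℝ) => t) (fun _ => by fun_prop)
  refine iIndepFun.hasGaussianLaw (X := fun (i : Fin k) (x : Fin k → ℝ) => x i) ?_ hind
  intro i
  constructor
  have := (measurePreserving_eval (fun _ : Fin k => gaussianReal 0 v) i).map_eq
  change IsGaussian (Measure.map (Function.eval i) (Measure.pi fun _ : Fin k => gaussianReal 0 v))
  rw [this]; infer_instance

lemma cov_coord {k : ℕ} (v : NNReal) (i j : Fin k) :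
    cov[fun x : Fin k → ℝ => x i, fun x => x j; Measure.pi fun _ => gaussianReal 0 v] =
      if i = j then (v : ℝ) else 0 := by
  have hind : iIndepFun (fun (i : Fin k) (x : Fin k → ℝ) => x i)
      (Measure.pi fun _ => gaussianReal 0 v) :=
    iIndepFun_pi (X := fun _ (t : ℝ) => t) (fun _ => by fun_prop)
  have hid (i : Fin k) := (gauss_id (k := k) v).map_fun (ContinuousLinearMap.proj (R := ℝ) i)
  split_ifs with h
  · subst h
    rw [covariance_self (measurable_pi_apply i).aemeasurable]
    have := (measurePreserving_eval (fun _ : Fin k => gaussianReal 0 v) i).map_eq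
    have h2 := variance_id_map (X := fun x : Fin k → ℝ => x i)
      (μ := Measure.pi fun _ => gaussianReal 0 v) (measurable_pi_apply i).aemeasurable
    rw [← h2]
    change Var[id; Measure.map (Function.eval i) (Measure.pi fun _ : Fin k => gaussianReal 0 v)] = _
    rw [this]; simp
  · exact (hind.indepFun h).covariance_eq_zero
      (hid i).memLp_two (hid j).memLp_two

lemma mean_coord {k : ℕ} (v : NNReal) (i : Fin k) :
    ∫ x : Fin k → ℝ, x i ∂(Measure.pi fun _ => gaussianReal 0 v) = 0 := by
  rw [integral_comp_eval (μ := fun _ : Fin k => gaussianReal 0 v) (f := fun t : ℝ => t)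
    (by fun_prop)]
  simp

/-- spherical-symmetry reduction of a Gaussian vector integral.
For a bounded measurable odd `g : ℝ → ℝ` and
`G(w) = E_{x ∼ N(0, σ²I_k)}[g(⟨x,w⟩) x]`, one has `G(0) = 0` and, for `w ≠ 0`,
`G(w) = 2σ (∫_0^∞ g(tσ‖w‖₂) φ(t) t dt) · w/‖w‖₂`. -/
theorem stmt9 (k : ℕ) (hk : 1 ≤ k) (σ : ℝ) (hσ : 0 < σ)
    (g : ℝ → ℝ) (hmeas : Measurable g) (hbdd : ∃ B, ∀ z, |g z| ≤ B)
    (hodd : ∀ z, g (-z) = -g z)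
    (μ : Measure (Fin k → ℝ))
    (hμ : μ = Measure.pi fun _ => gaussianReal 0 (Real.toNNReal (σ ^ 2)))
    (G : (Fin k → ℝ) → Fin k → ℝ)
    (hG : ∀ w, G w = ∫ x, g (∑ i, x i * w i) • x ∂μ) :
    G 0 = 0 ∧
      ∀ w : Fin k → ℝ, w ≠ 0 →
        G w = (2 * σ *
            ∫ t in Set.Ioi (0 : ℝ),
              g (t * σ * Real.sqrt (∑ i, w i ^ 2)) *
                ((Real.sqrt (2 * Real.pi))⁻¹ * Real.exp (-t ^ 2 / 2)) * t) •
          ((Real.sqrt (∑ i, w i ^ 2))⁻¹ • w) := by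
  obtain ⟨B, hB⟩ := hbdd
  set v := Real.toNNReal (σ ^ 2) with hv
  have hid : HasGaussianLaw (fun x : Fin k → ℝ => x) μ := by rw [hμ]; exact gauss_id v
  have hprob := hid.isProbabilityMeasure
  have hcov : ∀ i j, cov[fun x : Fin k → ℝ => x i, fun x => x j; μ] =
      if i = j then (v : ℝ) else 0 := by rw [hμ]; exact cov_coord v
  have hmean : ∀ i, ∫ x : Fin k → ℝ, x i ∂μ = 0 := by rw [hμ]; exact mean_coord v
  have hL : ∀ i, MemLp (fun x : Fin k → ℝ => x i) 2 μ := fun i =>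
    (hid.map_fun (ContinuousLinearMap.proj (R := ℝ) i)).memLp_two
  have hI : ∀ i, Integrable (fun x : Fin k → ℝ => x i) μ := fun i =>
    (hid.map_fun (ContinuousLinearMap.proj (R := ℝ) i)).integrable
  have hvσ : (v : ℝ) = σ ^ 2 := Real.coe_toNNReal _ (sq_nonneg σ)
  have hg0 : g 0 = 0 := by have := hodd 0; simp at this; linarith
  refine ⟨by rw [hG]; simp [hg0], fun w hw => ?_⟩
  have hn2 : 0 < ∑ i, w i ^ 2 := by
    obtain ⟨i, hi⟩ := Function.ne_iff.mp hw
    exact Finset.sum_pos' (fun i _ => sq_nonneg _) ⟨i, Finset.mem_univ _, by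
      have : w i ≠ 0 := hi
      positivity⟩
  set N := Real.sqrt (∑ i, w i ^ 2) with hN
  have hNpos : 0 < N := Real.sqrt_pos.mpr hn2
  have hNsq : N ^ 2 = ∑ i, w i ^ 2 := Real.sq_sqrt hn2.le
  let Y : (Fin k → ℝ) → ℝ := fun x => ∑ i, x i * w i
  have hYm : Measurable Y := by fun_prop
  let LY : (Fin k → ℝ) →L[ℝ] ℝ := ∑ i, w i • ContinuousLinearMap.proj (R := ℝ) i
  have hLY : ∀ x, LY x = Y x := fun x => by
    simp [LY, Y, mul_comm]
  have hYG : HasGaussianLaw Y μ := by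
    have := hid.map_fun LY
    simpa only [hLY] using this
  have hcovY : ∀ j, cov[fun x : Fin k → ℝ => x j, Y; μ] = σ ^ 2 * w j := by
    intro j
    simp only [Y]
    rw [covariance_fun_sum_right (fun i => (hL i).mul_const (w i)) (hL j)]
    simp [covariance_mul_const_right, hcov, hvσ]
  have hvarY : Var[Y; μ] = (σ * N) ^ 2 := by
    rw [← covariance_self hYm.aemeasurable]
    conv_lhs => arg 1; simp only [Y]
    rw [covariance_fun_sum_left (fun i => (hL i).mul_const (w i)) hYG.memLp_two]
    simp only [covariance_mul_const_left, hcovY]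
    rw [mul_pow, hNsq, Finset.mul_sum]
    exact Finset.sum_congr rfl fun i _ => by ring
  have hmeanY : ∫ x, Y x ∂μ = 0 := by
    simp only [Y]
    rw [integral_finsetSum _ (fun i _ => (hI i).mul_const (w i))]
    simp [integral_mul_const, hmean]
  have hmapY : μ.map Y = gaussianReal 0 (Real.toNNReal ((σ * N) ^ 2)) := by
    rw [hYG.map_eq_gaussianReal, hmeanY, hvarY]
  have hgI : ∀ f : (Fin k → ℝ) → ℝ, Integrable f μ → Integrable (fun x => g (Y x) * f x) μ := by
    intro f hf
    exact hf.bdd_mul (c := B) (hmeas.comp hYm).aestronglyMeasurable (.of_forall fun x => hB _)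
  have hEY : ∫ x, g (Y x) * Y x ∂μ = 2 * (σ * N) * ∫ t in Set.Ioi (0 : ℝ),
        g (t * (σ * N)) * ((Real.sqrt (2 * Real.pi))⁻¹ * Real.exp (-t ^ 2 / 2)) * t := by
    rw [← oneDim (σ * N) g hmeas hodd, ← hmapY, integral_map (by fun_prop) (by fun_prop)]
  ext j
  rw [hG, eval_integral (fun i => by simpa using hgI _ (hI i))]
  let R : (Fin k → ℝ) → ℝ := fun x => x j - (w j / N ^ 2) * Y x
  have hRG : HasGaussianLaw (fun x => (Y x, R x)) μ := by
    have := hid.map_fun (LY.prod (ContinuousLinearMap.proj (R := ℝ) j - (w j / N ^ 2) • LY))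
    simpa [hLY, R] using this
  have hcovR : cov[Y, R; μ] = 0 := by
    simp only [R]
    rw [covariance_fun_sub_right hYG.memLp_two (hL j) (hYG.memLp_two.const_mul _),
      covariance_const_mul_right, covariance_comm, hcovY, covariance_self hYm.aemeasurable, hvarY]
    field_simp
    ring
  have hmeanR : ∫ x, R x ∂μ = 0 := by
    simp only [R]
    rw [integral_sub (hI j) (hYG.integrable.const_mul _), integral_const_mul, hmean, hmeanY]
    simp
  have hind : IndepFun Y R μ := hRG.indepFun_of_covariance_eq_zero hcovR
  have hER : ∫ x, g (Y x) * R x ∂μ = 0 := by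
    have h := (hind.comp hmeas measurable_id).integral_fun_mul_eq_mul_integral
      (hmeas.comp hYm).aestronglyMeasurable (by fun_prop)
    simp only [Function.comp_def, id] at h
    rw [h, hmeanR, mul_zero]
  have hsplit : ∫ x : Fin k → ℝ, g (Y x) * x j ∂μ = (w j / N ^ 2) * ∫ x, g (Y x) * Y x ∂μ := by
    have h : ∀ x : Fin k → ℝ, g (Y x) * x j = (w j / N ^ 2) * (g (Y x) * Y x) + g (Y x) * R x := by
      intro x; simp only [R]; ring
    simp_rw [h]
    rw [integral_add ((hgI _ hYG.integrable).const_mul _) (hgI _ hRG.snd.integrable),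
      hER, integral_const_mul, add_zero]
  change ∫ x : Fin k → ℝ, g (Y x) * x j ∂μ = _
  rw [hsplit, hEY]
  simp only [Pi.smul_apply, smul_eq_mul, ← mul_assoc]
  field_simp
end
end

section
/- Fix integers 1 ≤ s < d and σ₁ > 0. Let x ∼ N(0, σ₁² I_d), and for a parameter w̃ ∈ ℝ^d define the population logistic loss f_{w̃}(w) := −E_x[ σ(⟨x, w̃⟩) log σ(⟨x, w⟩) + σ(−⟨x, w̃⟩) log σ(−⟨x, w⟩) ], where σ(z) = 1/(1 + e^{−z}). Let α ∈ ℝ^s, β ∈ ℝ^{d−s}, w̃¹ := (αᵀ, βᵀ)ᵀ and w̃² := (αᵀ, −βᵀ)ᵀ. Then there exists γ > 0 such that w* = (γαᵀ, 0_{d−s}ᵀ)ᵀ is the unique global minimizer of f := (f_{w̃¹} + f_{w̃²})/2. -/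
noncomputable section

open Real MeasureTheory ProbabilityTheory
open scoped Matrix

theorem aux_map {n : ℕ} (σ1 : ℝ) :
    (Measure.pi fun _ : Fin n => gaussianReal 0 (Real.toNNReal (σ1 ^ 2))).map (WithLp.toLp 2)
      = (stdGaussian (EuclideanSpace ℝ (Fin n))).map (fun y => σ1 • y) := by
  rw [← map_pi_eq_stdGaussian, Measure.map_map (by fun_prop) (by fun_prop)]
  have h : (Measure.pi fun _ : Fin n => gaussianReal 0 (Real.toNNReal (σ1 ^ 2))) =
      (Measure.pi fun _ : Fin n => gaussianReal 0 1).map (fun x i => σ1 * x i) := by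
    rw [Measure.pi_map_pi (f := fun (i : Fin n) (x : ℝ) => σ1 * x) (fun i => by fun_prop)]
    congr 1
    funext i
    rw [gaussianReal_map_const_mul]
    congr 1
    · simp
    · ext; simp [sq_nonneg]
  rw [h, Measure.map_map (by fun_prop) (by fun_prop)]
  rfl

theorem aux_refl {n : ℕ} (σ1 : ℝ) (q : Fin n → ℝ) (F : (Fin n → ℝ) → ℝ)
    (hF : ∀ x, F (x - (2 * ((x ⬝ᵥ q) / (q ⬝ᵥ q))) • q) = - F x) :
    ∫ x, F x ∂(Measure.pi fun _ : Fin n => gaussianReal 0 (Real.toNNReal (σ1 ^ 2))) = 0 := by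
  set μ := (Measure.pi fun _ : Fin n => gaussianReal 0 (Real.toNNReal (σ1 ^ 2)))
  let ν := (stdGaussian (EuclideanSpace ℝ (Fin n))).map (fun y => σ1 • y)
  let Q : EuclideanSpace ℝ (Fin n) := WithLp.toLp 2 q
  let R : EuclideanSpace ℝ (Fin n) ≃ₗᵢ[ℝ] EuclideanSpace ℝ (Fin n) := (ℝ ∙ Q)ᗮ.reflection
  have hR : ∀ y : EuclideanSpace ℝ (Fin n), (R y).ofLp = y.ofLp - (2 * ((y.ofLp ⬝ᵥ q) / (q ⬝ᵥ q))) • q := by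
    intro y
    have h2 : ‖Q‖ ^ 2 = q ⬝ᵥ q := by
      rw [EuclideanSpace.norm_sq_eq]
      simp [dotProduct, Q, sq]
    have h3 : inner ℝ Q y = y.ofLp ⬝ᵥ q := by
      simp [PiLp.inner_apply, dotProduct, Q]
    have h4 : R y = y - (2:ℝ) • (inner ℝ Q y / ‖Q‖ ^ 2) • Q := by
      simp only [R, Submodule.reflection_orthogonal_apply]
      rw [Submodule.reflection_singleton_apply, neg_sub, ← Nat.cast_smul_eq_nsmul ℝ]
      simp
    rw [h4, h2, h3]
    simp [Q, mul_smul]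
  have hν : ν.map R = ν := by
    have : ν.map R = ((stdGaussian (EuclideanSpace ℝ (Fin n))).map R).map (fun y => σ1 • y) := by
      simp only [ν]
      rw [Measure.map_map (by fun_prop) (by fun_prop), Measure.map_map (by fun_prop) (by fun_prop)]
      congr 1
      ext1 y
      simp
    rw [this, stdGaussian_map]
  have e1 : ∫ x, F x ∂μ = ∫ y, F (WithLp.ofLp y) ∂ν := by
    have : ν = μ.map (MeasurableEquiv.toLp 2 (Fin n → ℝ)) := (aux_map σ1).symm
    rw [this, MeasureTheory.integral_map_equiv]
    rfl
  have e2 : ∫ y, F (WithLp.ofLp y) ∂ν = - ∫ y, F (WithLp.ofLp y) ∂ν := by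
    conv_lhs => rw [← hν]
    have := MeasureTheory.integral_map_equiv (μ := ν) (R.toHomeomorph.toMeasurableEquiv)
      (fun y : EuclideanSpace ℝ (Fin n) => F (WithLp.ofLp y))
    refine this.trans ?_
    rw [← integral_neg]
    congr 1
    ext y
    have := hF y.ofLp
    rw [← hR] at this
    exact this
  rw [e1]; linarith

theorem aux_int {n : ℕ} (σ1 : ℝ) (v : Fin n → ℝ) :
   Integrable (fun x => x ⬝ᵥ v) (Measure.pi fun _ : Fin n => gaussianReal 0 (Real.toNNReal (σ1 ^ 2))) := by
  unfold dotProduct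
  refine integrable_finsetSum _ fun i _ => Integrable.mul_const ?_ _
  exact integrable_eval IsGaussian.integrable_id

theorem aux_open {n : ℕ} (σ1 : ℝ) (h : 0 < σ1) :
   (Measure.pi fun _ : Fin n => gaussianReal 0 (Real.toNNReal (σ1 ^ 2))).IsOpenPosMeasure := by
  have : (gaussianReal 0 (Real.toNNReal (σ1 ^ 2))).IsOpenPosMeasure :=
    (gaussianReal_absolutelyContinuous' 0 (by simp; positivity)).isOpenPosMeasure
  infer_instance

theorem aux_pos {n : ℕ} (σ1 : ℝ) (h : 0 < σ1) (F : (Fin n → ℝ) → ℝ) (hc : Continuous F)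
   (hi : Integrable F (Measure.pi fun _ : Fin n => gaussianReal 0 (Real.toNNReal (σ1 ^ 2))))
   (h0 : ∀ x, 0 ≤ F x) (x0 : Fin n → ℝ) (hx : 0 < F x0) :
   0 < ∫ x, F x ∂(Measure.pi fun _ : Fin n => gaussianReal 0 (Real.toNNReal (σ1 ^ 2))) := by
  have := aux_open (n := n) σ1 h
  rw [integral_pos_iff_support_of_nonneg h0 hi]
  exact hc.isOpen_support.measure_pos _ ⟨x0, hx.ne'⟩

/-- softplus -/
def spl (z : ℝ) : ℝ := Real.log (1 + Real.exp z)

theorem spl_neg (z : ℝ) : spl (-z) = spl z - z := by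
  unfold spl
  have : 1 + exp z = exp z * (1 + exp (-z)) := by rw [mul_add, ← exp_add]; simp [add_comm]
  rw [this, log_mul (by positivity) (by positivity), log_exp]; ring

theorem log_sigmoid' (z : ℝ) : Real.log (Real.sigmoid z) = z - spl z := by
  have := spl_neg z
  rw [sigmoid_def, log_inv]
  unfold spl at *
  linarith

theorem spl_cont : Continuous spl := by
  unfold spl
  exact Continuous.log (by fun_prop) (fun x => by positivity)

theorem spl_deriv (z : ℝ) : HasDerivAt spl (Real.sigmoid z) z := by
  have h := ((Real.hasDerivAt_exp z).const_add 1).log (by positivity)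
  have e : Real.sigmoid z = exp z / (1 + exp z) := by
    rw [sigmoid_def, exp_neg]
    have := exp_pos z
    field_simp
    ring
  rw [e]
  exact h

theorem spl_strict (b c : ℝ) (h : b ≠ c) : Real.sigmoid c * (b - c) < spl b - spl c := by
  have hd : deriv spl = Real.sigmoid := funext fun z => (spl_deriv z).deriv
  rcases lt_or_gt_of_ne h with h | h
  · obtain ⟨ξ, h1, h2⟩ := exists_deriv_eq_slope spl h spl_cont.continuousOn
      (fun z _ => (spl_deriv z).differentiableAt.differentiableWithinAt)
    rw [hd, eq_div_iff (by linarith)] at h2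
    have := Real.sigmoid_lt h1.2
    nlinarith
  · obtain ⟨ξ, h1, h2⟩ := exists_deriv_eq_slope spl h spl_cont.continuousOn
      (fun z _ => (spl_deriv z).differentiableAt.differentiableWithinAt)
    rw [hd, eq_div_iff (by linarith)] at h2
    have := Real.sigmoid_lt h1.1
    nlinarith

theorem spl_bound (b : ℝ) : |spl b| ≤ Real.log 2 + |b| := by
  have h0 : 0 ≤ spl b := Real.log_nonneg (by have := exp_pos b; linarith)
  rw [abs_of_nonneg h0, ← Real.log_exp |b|, ← log_mul (by norm_num) (by positivity)]
  apply Real.log_le_log (by positivity)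
  have h1 : (1:ℝ) ≤ exp |b| := Real.one_le_exp (abs_nonneg b)
  have h2 : exp b ≤ exp |b| := exp_le_exp.2 (le_abs_self b)
  linarith

/-- the averaged label probability -/
def hh {n : ℕ} (A B x : Fin n → ℝ) : ℝ :=
  (Real.sigmoid (x ⬝ᵥ A + x ⬝ᵥ B) + Real.sigmoid (x ⬝ᵥ A - x ⬝ᵥ B)) / 2

theorem dot_cont {n : ℕ} (v : Fin n → ℝ) : Continuous fun x : Fin n → ℝ => x ⬝ᵥ v := by
  unfold dotProduct
  fun_prop

theorem hh_cont {n : ℕ} (A B : Fin n → ℝ) : Continuous (hh A B) := by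
  have h1 := dot_cont A
  have h2 := dot_cont B
  exact ((continuous_sigmoid.comp (h1.add h2)).add (continuous_sigmoid.comp (h1.sub h2))).div_const 2

theorem hh_pos {n : ℕ} (A B x : Fin n → ℝ) : 0 < hh A B x := by
  unfold hh
  have := Real.sigmoid_pos (x ⬝ᵥ A + x ⬝ᵥ B)
  have := Real.sigmoid_pos (x ⬝ᵥ A - x ⬝ᵥ B)
  linarith

theorem hh_lt {n : ℕ} (A B x : Fin n → ℝ) : hh A B x < 1 := by
  unfold hh
  have := Real.sigmoid_lt_one (x ⬝ᵥ A + x ⬝ᵥ B)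
  have := Real.sigmoid_lt_one (x ⬝ᵥ A - x ⬝ᵥ B)
  linarith

theorem hh_sign {n : ℕ} (A B x : Fin n → ℝ) (hx : x ⬝ᵥ A ≠ 0) :
    0 < (hh A B x - 1 / 2) * (x ⬝ᵥ A) := by
  unfold hh
  have e := Real.sigmoid_neg (x ⬝ᵥ A - x ⬝ᵥ B)
  rcases lt_or_gt_of_ne hx with h | h
  · have := Real.sigmoid_lt (show x ⬝ᵥ A + x ⬝ᵥ B < -(x ⬝ᵥ A - x ⬝ᵥ B) by linarith)
    exact mul_pos_of_neg_of_neg (by linarith) h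
  · have := Real.sigmoid_lt (show -(x ⬝ᵥ A - x ⬝ᵥ B) < x ⬝ᵥ A + x ⬝ᵥ B by linarith)
    exact mul_pos (by linarith) h

theorem sub_bound {n : ℕ} (A B x : Fin n → ℝ) (z y : ℝ) :
    |(Real.sigmoid z - hh A B x) * y| ≤ |y| := by
  rw [abs_mul]
  refine mul_le_of_le_one_left (abs_nonneg _) ?_
  have h1 := Real.sigmoid_pos z
  have h2 := Real.sigmoid_lt_one z
  have h3 := hh_pos A B x
  have h4 := hh_lt A B x
  rw [abs_le]; constructor <;> linarith

theorem res_cont {n : ℕ} (A B C v : Fin n → ℝ) :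
    Continuous (fun x => (Real.sigmoid (x ⬝ᵥ C) - hh A B x) * (x ⬝ᵥ v)) :=
  ((continuous_sigmoid.comp (dot_cont C)).sub (hh_cont A B)).mul (dot_cont v)

theorem res_int {n : ℕ} (σ1 : ℝ) (A B C v : Fin n → ℝ) :
    Integrable (fun x => (Real.sigmoid (x ⬝ᵥ C) - hh A B x) * (x ⬝ᵥ v))
      (Measure.pi fun _ : Fin n => gaussianReal 0 (Real.toNNReal (σ1 ^ 2))) :=
  (aux_int σ1 v).mono (res_cont A B C v).aestronglyMeasurable
    (Filter.Eventually.of_forall fun x => sub_bound A B x _ _)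

theorem exists_gamma {n : ℕ} (σ1 : ℝ) (hσ : 0 < σ1) (A B : Fin n → ℝ) :
    ∃ γ : ℝ, 0 < γ ∧ ∫ x, (Real.sigmoid (x ⬝ᵥ (γ • A)) - hh A B x) * (x ⬝ᵥ A)
      ∂(Measure.pi fun _ : Fin n => gaussianReal 0 (Real.toNNReal (σ1 ^ 2))) = 0 := by
  by_cases hA : A = 0
  · subst hA
    exact ⟨1, one_pos, by simp⟩
  set μ := (Measure.pi fun _ : Fin n => gaussianReal 0 (Real.toNNReal (σ1 ^ 2))) with hμ
  have hAA : 0 < A ⬝ᵥ A := by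
    have h1 : A ⬝ᵥ A ≠ 0 := fun h => hA (dotProduct_self_eq_zero.1 h)
    have h2 : 0 ≤ A ⬝ᵥ A := Finset.sum_nonneg fun i _ => mul_self_nonneg _
    exact lt_of_le_of_ne h2 h1.symm
  let φ : ℝ → ℝ := fun γ => ∫ x, (Real.sigmoid (x ⬝ᵥ (γ • A)) - hh A B x) * (x ⬝ᵥ A) ∂μ
  have hcont : Continuous φ := by
    refine continuous_of_dominated (bound := fun x => |x ⬝ᵥ A|)
      (fun γ => (res_cont A B (γ • A) A).aestronglyMeasurable)
      (fun γ => Filter.Eventually.of_forall fun x => sub_bound A B x _ _)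
      (aux_int σ1 A).abs (Filter.Eventually.of_forall fun x => ?_)
    simp only [dotProduct_smul, smul_eq_mul]
    have : Continuous fun γ : ℝ => Real.sigmoid (γ * (x ⬝ᵥ A)) :=
      continuous_sigmoid.comp (by fun_prop)
    fun_prop
  have h0 : φ 0 < 0 := by
    have := aux_pos σ1 hσ (fun x => - ((Real.sigmoid (x ⬝ᵥ ((0:ℝ) • A)) - hh A B x) * (x ⬝ᵥ A)))
      (res_cont A B _ A).neg (res_int σ1 A B _ A).neg
      (fun x => by
        by_cases hx : x ⬝ᵥ A = 0
        · simp [hx]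
        · have := hh_sign A B x hx
          simp only [zero_smul, dotProduct_zero, Real.sigmoid_zero]
          norm_num at this ⊢
          linarith) A
      (by
          have := hh_sign A B A hAA.ne'
          simp only [zero_smul, dotProduct_zero, Real.sigmoid_zero]
          norm_num at this ⊢
          linarith)
    rw [integral_neg] at this
    change 0 < - φ 0 at this
    linarith
  let G : (Fin n → ℝ) → ℝ := fun x => max (x ⬝ᵥ A) 0 - hh A B x * (x ⬝ᵥ A)
  have hlim : Filter.Tendsto (fun k : ℕ => φ k) Filter.atTop (nhds (∫ x, G x ∂μ)) := by
    refine tendsto_integral_of_dominated_convergence (fun x => |x ⬝ᵥ A|)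
      (fun k => (res_cont A B _ A).aestronglyMeasurable) (aux_int σ1 A).abs
      (fun k => Filter.Eventually.of_forall fun x => sub_bound A B x _ _)
      (Filter.Eventually.of_forall fun x => ?_)
    simp only [dotProduct_smul, smul_eq_mul, sub_mul, G]
    refine Filter.Tendsto.sub_const ?_ _
    rcases lt_trichotomy (x ⬝ᵥ A) 0 with h | h | h
    · rw [max_eq_right h.le]
      have := (tendsto_sigmoid_atBot.comp
        (tendsto_natCast_atTop_atTop (R := ℝ) |>.atTop_mul_const_of_neg h)).mul_const (x ⬝ᵥ A)
      simpa using this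
    · simp [h]
    · rw [max_eq_left h.le]
      have := (tendsto_sigmoid_atTop.comp
        (tendsto_natCast_atTop_atTop (R := ℝ) |>.atTop_mul_const h)).mul_const (x ⬝ᵥ A)
      simpa using this
  have hGc : Continuous G := ((dot_cont A).max continuous_const).sub ((hh_cont A B).mul (dot_cont A))
  have hGn : ∀ x, 0 ≤ G x := by
    intro x
    have h3 := hh_pos A B x
    have h4 := hh_lt A B x
    rcases le_total (x ⬝ᵥ A) 0 with h | h
    · simp only [G, max_eq_right h]; nlinarith
    · simp only [G, max_eq_left h]; nlinarith
  have hGi : Integrable G μ := by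
    refine (aux_int σ1 A).mono hGc.aestronglyMeasurable (Filter.Eventually.of_forall fun x => ?_)
    rw [Real.norm_of_nonneg (hGn x), Real.norm_eq_abs]
    have h3 := hh_pos A B x
    have h4 := hh_lt A B x
    rcases le_total (x ⬝ᵥ A) 0 with h | h
    · simp only [G, max_eq_right h, abs_of_nonpos h]; nlinarith
    · simp only [G, max_eq_left h, abs_of_nonneg h]; nlinarith
  have hGpos : 0 < ∫ x, G x ∂μ := by
    refine aux_pos σ1 hσ G hGc hGi hGn A ?_
    have h4 := hh_lt A B A
    simp only [G, max_eq_left hAA.le]; nlinarith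
  obtain ⟨k, hk⟩ := (hlim.eventually (lt_mem_nhds hGpos)).exists
  have hk0 : (0:ℝ) ≤ k := Nat.cast_nonneg k
  obtain ⟨γ, hγ, hγ0⟩ := intermediate_value_Icc hk0 hcont.continuousOn ⟨h0.le, hk.le⟩
  refine ⟨γ, lt_of_le_of_ne hγ.1 ?_, hγ0⟩
  rintro rfl
  exact h0.ne hγ0

theorem ortho_all {n : ℕ} (σ1 : ℝ) (A B : Fin n → ℝ) (hAB : A ⬝ᵥ B = 0) (γ : ℝ)
    (hγ : ∫ x, (Real.sigmoid (x ⬝ᵥ (γ • A)) - hh A B x) * (x ⬝ᵥ A)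
      ∂(Measure.pi fun _ : Fin n => gaussianReal 0 (Real.toNNReal (σ1 ^ 2))) = 0)
    (v : Fin n → ℝ) :
    ∫ x, (Real.sigmoid (x ⬝ᵥ (γ • A)) - hh A B x) * (x ⬝ᵥ v)
      ∂(Measure.pi fun _ : Fin n => gaussianReal 0 (Real.toNNReal (σ1 ^ 2))) = 0 := by
  set μ := (Measure.pi fun _ : Fin n => gaussianReal 0 (Real.toNNReal (σ1 ^ 2))) with hμ
  have key : ∀ q : Fin n → ℝ, q ⬝ᵥ A = 0 → (q ⬝ᵥ B = 0 ∨ q = B) →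
      ∫ x, (Real.sigmoid (x ⬝ᵥ (γ • A)) - hh A B x) * (x ⬝ᵥ q) ∂μ = 0 := by
    intro q hqA hqB
    apply aux_refl σ1 q
    intro x
    by_cases hq : q = 0
    · subst hq; simp
    have hqq : q ⬝ᵥ q ≠ 0 := fun h => hq (dotProduct_self_eq_zero.1 h)
    set c := 2 * ((x ⬝ᵥ q) / (q ⬝ᵥ q)) with hc
    have e1 : (x - c • q) ⬝ᵥ A = x ⬝ᵥ A := by simp [sub_dotProduct, hqA]
    have e2 : (x - c • q) ⬝ᵥ q = - (x ⬝ᵥ q) := by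
      rw [sub_dotProduct, smul_dotProduct, smul_eq_mul, hc]; field_simp; ring
    have e3 : hh A B (x - c • q) = hh A B x := by
      rcases hqB with h | h
      · have : (x - c • q) ⬝ᵥ B = x ⬝ᵥ B := by simp [sub_dotProduct, h]
        simp only [hh, e1, this]
      · rw [h] at e1 e2 ⊢
        simp only [hh, e1, e2]
        rw [sub_neg_eq_add, ← sub_eq_add_neg, add_comm]
    rw [e3, e2, dotProduct_smul, e1, dotProduct_smul]; ring
  have hBA : B ⬝ᵥ A = 0 := by rw [dotProduct_comm]; exact hAB
  let a := (v ⬝ᵥ A) / (A ⬝ᵥ A)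
  let b := (v ⬝ᵥ B) / (B ⬝ᵥ B)
  let q := v - a • A - b • B
  have hqA : q ⬝ᵥ A = 0 := by
    simp only [q, sub_dotProduct, smul_dotProduct, hBA, smul_eq_mul, a]
    by_cases h : A = 0
    · simp [h]
    have : A ⬝ᵥ A ≠ 0 := fun h' => h (dotProduct_self_eq_zero.1 h')
    field_simp; ring
  have hqB : q ⬝ᵥ B = 0 := by
    simp only [q, sub_dotProduct, smul_dotProduct, hAB, smul_eq_mul, b]
    by_cases h : B = 0
    · simp [h]
    have : B ⬝ᵥ B ≠ 0 := fun h' => h (dotProduct_self_eq_zero.1 h')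
    field_simp; ring
  have hv : v = q + a • A + b • B := by simp only [q]; abel
  have k1 := key q hqA (Or.inl hqB)
  have k2 := key B hBA (Or.inr rfl)
  have : ∀ x, (Real.sigmoid (x ⬝ᵥ (γ • A)) - hh A B x) * (x ⬝ᵥ v) =
      ((Real.sigmoid (x ⬝ᵥ (γ • A)) - hh A B x) * (x ⬝ᵥ q) +
      a * ((Real.sigmoid (x ⬝ᵥ (γ • A)) - hh A B x) * (x ⬝ᵥ A))) +
      b * ((Real.sigmoid (x ⬝ᵥ (γ • A)) - hh A B x) * (x ⬝ᵥ B)) := by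
    intro x
    rw [hv]
    simp only [dotProduct_add, dotProduct_smul, smul_eq_mul]
    ring
  simp_rw [this]
  rw [integral_add, integral_add, integral_const_mul, integral_const_mul, k1, k2, hγ]
  · simp
  · exact res_int σ1 A B _ q
  · exact (res_int σ1 A B _ A).const_mul a
  · exact (res_int σ1 A B _ q).add ((res_int σ1 A B _ A).const_mul a)
  · exact (res_int σ1 A B _ B).const_mul b

theorem spl_int {n : ℕ} (σ1 : ℝ) (w : Fin n → ℝ) :
    Integrable (fun x => spl (x ⬝ᵥ w))
      (Measure.pi fun _ : Fin n => gaussianReal 0 (Real.toNNReal (σ1 ^ 2))) :=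
  ((integrable_const (Real.log 2)).add (aux_int σ1 w).abs).mono'
    (spl_cont.comp (dot_cont w)).aestronglyMeasurable
    (Filter.Eventually.of_forall fun x => spl_bound _)

theorem sigdot_int {n : ℕ} (σ1 : ℝ) (C w : Fin n → ℝ) :
    Integrable (fun x => Real.sigmoid (x ⬝ᵥ C) * (x ⬝ᵥ w))
      (Measure.pi fun _ : Fin n => gaussianReal 0 (Real.toNNReal (σ1 ^ 2))) := by
  refine (aux_int σ1 w).mono
    ((continuous_sigmoid.comp (dot_cont C)).mul (dot_cont w)).aestronglyMeasurable
    (Filter.Eventually.of_forall fun x => ?_)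
  rw [norm_mul, Real.norm_of_nonneg (Real.sigmoid_nonneg _)]
  exact mul_le_of_le_one_left (norm_nonneg _) (Real.sigmoid_le_one _)

theorem loss_eq {n : ℕ} (σ1 : ℝ) (C w : Fin n → ℝ) :
    -∫ x, (Real.sigmoid (x ⬝ᵥ C) * Real.log (Real.sigmoid (x ⬝ᵥ w)) +
        Real.sigmoid (-(x ⬝ᵥ C)) * Real.log (Real.sigmoid (-(x ⬝ᵥ w))))
      ∂(Measure.pi fun _ : Fin n => gaussianReal 0 (Real.toNNReal (σ1 ^ 2))) =
    ∫ x, (spl (x ⬝ᵥ w) - Real.sigmoid (x ⬝ᵥ C) * (x ⬝ᵥ w))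
      ∂(Measure.pi fun _ : Fin n => gaussianReal 0 (Real.toNNReal (σ1 ^ 2))) := by
  rw [← integral_neg]
  congr 1
  ext x
  rw [log_sigmoid', log_sigmoid', spl_neg, Real.sigmoid_neg]
  ring

theorem avg_eq {n : ℕ} (σ1 : ℝ) (A B w : Fin n → ℝ) :
    ((∫ x, (spl (x ⬝ᵥ w) - Real.sigmoid (x ⬝ᵥ (A + B)) * (x ⬝ᵥ w))
      ∂(Measure.pi fun _ : Fin n => gaussianReal 0 (Real.toNNReal (σ1 ^ 2)))) +
    ∫ x, (spl (x ⬝ᵥ w) - Real.sigmoid (x ⬝ᵥ (A - B)) * (x ⬝ᵥ w))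
      ∂(Measure.pi fun _ : Fin n => gaussianReal 0 (Real.toNNReal (σ1 ^ 2)))) / 2 =
    ∫ x, (spl (x ⬝ᵥ w) - hh A B x * (x ⬝ᵥ w))
      ∂(Measure.pi fun _ : Fin n => gaussianReal 0 (Real.toNNReal (σ1 ^ 2))) := by
  have e := integral_add ((spl_int σ1 w).sub (sigdot_int σ1 (A + B) w))
    ((spl_int σ1 w).sub (sigdot_int σ1 (A - B) w))
  simp only [Pi.sub_apply] at e
  rw [← e, ← integral_div]
  congr 1
  ext x
  simp only [hh, dotProduct_add, dotProduct_sub]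
  ring

theorem hhdot_int {n : ℕ} (σ1 : ℝ) (A B w : Fin n → ℝ) :
    Integrable (fun x => hh A B x * (x ⬝ᵥ w))
      (Measure.pi fun _ : Fin n => gaussianReal 0 (Real.toNNReal (σ1 ^ 2))) := by
  refine (aux_int σ1 w).mono
    ((hh_cont A B).mul (dot_cont w)).aestronglyMeasurable
    (Filter.Eventually.of_forall fun x => ?_)
  rw [norm_mul, Real.norm_of_nonneg (hh_pos A B x).le]
  exact mul_le_of_le_one_left (norm_nonneg _) (hh_lt A B x).le

theorem core {n : ℕ} (σ1 : ℝ) (hσ : 0 < σ1) (A B : Fin n → ℝ) (hAB : A ⬝ᵥ B = 0) :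
    ∃ γ : ℝ, 0 < γ ∧ ∀ w : Fin n → ℝ, w ≠ γ • A →
    ∫ x, (spl (x ⬝ᵥ (γ • A)) - hh A B x * (x ⬝ᵥ (γ • A)))
      ∂(Measure.pi fun _ : Fin n => gaussianReal 0 (Real.toNNReal (σ1 ^ 2))) <
    ∫ x, (spl (x ⬝ᵥ w) - hh A B x * (x ⬝ᵥ w))
      ∂(Measure.pi fun _ : Fin n => gaussianReal 0 (Real.toNNReal (σ1 ^ 2))) := by
  obtain ⟨γ, hγ, h⟩ := exists_gamma σ1 hσ A B
  refine ⟨γ, hγ, fun w hw => ?_⟩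
  have ho := ortho_all σ1 A B hAB γ h (w - γ • A)
  set W := γ • A with hW
  have i1 := (spl_int σ1 w).sub (hhdot_int σ1 A B w)
  have i2 := (spl_int σ1 W).sub (hhdot_int σ1 A B W)
  have i3 := res_int σ1 A B W (w - W)
  have i4 := (i1.sub i2).sub i3
  have hD : ∀ x : Fin n → ℝ, ((spl (x ⬝ᵥ w) - hh A B x * (x ⬝ᵥ w)) -
      (spl (x ⬝ᵥ W) - hh A B x * (x ⬝ᵥ W))) -
      (Real.sigmoid (x ⬝ᵥ W) - hh A B x) * (x ⬝ᵥ (w - W)) =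
      spl (x ⬝ᵥ w) - spl (x ⬝ᵥ W) - Real.sigmoid (x ⬝ᵥ W) * (x ⬝ᵥ w - x ⬝ᵥ W) := by
    intro x
    rw [dotProduct_sub]; ring
  have hp := aux_pos σ1 hσ (fun x => ((spl (x ⬝ᵥ w) - hh A B x * (x ⬝ᵥ w)) -
      (spl (x ⬝ᵥ W) - hh A B x * (x ⬝ᵥ W))) -
      (Real.sigmoid (x ⬝ᵥ W) - hh A B x) * (x ⬝ᵥ (w - W)))
    ((((spl_cont.comp (dot_cont w)).sub ((hh_cont A B).mul (dot_cont w))).sub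
      ((spl_cont.comp (dot_cont W)).sub ((hh_cont A B).mul (dot_cont W)))).sub
      (res_cont A B W (w - W))) i4
    (fun x => by
      simp only [hD]
      by_cases hx : x ⬝ᵥ w = x ⬝ᵥ W
      · simp [hx]
      · have := spl_strict _ _ hx
        linarith) (w - W)
    (by
      simp only [hD]
      have hx : (w - W) ⬝ᵥ w ≠ (w - W) ⬝ᵥ W := by
        intro hx
        rw [← sub_eq_zero, ← dotProduct_sub] at hx
        exact hw (sub_eq_zero.1 (dotProduct_self_eq_zero.1 hx))
      have := spl_strict _ _ hx
      linarith)
  have e' := integral_sub (i1.sub i2) i3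
  simp only [Pi.sub_apply] at e'
  rw [e', ho] at hp
  have e := integral_sub i1 i2
  simp only [Pi.sub_apply] at e
  rw [e] at hp
  linarith

/-- decentralized sparse logistic regression with two paired
clients.  Writing `d = s + t` (so `1 ≤ s < d`), with standard-Gaussian-type
covariates `x ∼ N(0, σ₁² I_d)`, client parameters `w̃¹ = (α, β)` and
`w̃² = (α, −β)`, there is `γ > 0` such that `w* = (γα, 0)` is the unique
global minimizer of the averaged population logistic loss. -/
theorem stmt12 (s t : ℕ) (hs : 1 ≤ s) (ht : 1 ≤ t)
    (σ1 : ℝ) (hσ1 : 0 < σ1)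
    (μ : Measure (Fin (s + t) → ℝ))
    (hμ : μ = Measure.pi fun _ => gaussianReal 0 (Real.toNNReal (σ1 ^ 2)))
    (sig : ℝ → ℝ) (hsig : ∀ z, sig z = (1 + Real.exp (-z))⁻¹)
    (floss : (Fin (s + t) → ℝ) → (Fin (s + t) → ℝ) → ℝ)
    (hfloss : ∀ wtil w, floss wtil w =
      -∫ x, (sig (∑ i, x i * wtil i) * Real.log (sig (∑ i, x i * w i)) +
        sig (-∑ i, x i * wtil i) * Real.log (sig (-∑ i, x i * w i))) ∂μ)
    (α : Fin s → ℝ) (β : Fin t → ℝ)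
    (f : (Fin (s + t) → ℝ) → ℝ)
    (hf : ∀ w, f w =
      (floss (Fin.append α β) w + floss (Fin.append α (-β)) w) / 2) :
    ∃ γ : ℝ, 0 < γ ∧
      ∀ w : Fin (s + t) → ℝ, w ≠ Fin.append (γ • α) 0 →
        f (Fin.append (γ • α) 0) < f w := by
  obtain rfl : sig = Real.sigmoid := funext fun z => by rw [hsig, Real.sigmoid_def]
  subst hμ
  let A : Fin (s + t) → ℝ := Fin.append α 0
  let B : Fin (s + t) → ℝ := Fin.append 0 β
  have hAB : A ⬝ᵥ B = 0 := by
    simp [dotProduct, Fin.sum_univ_add, A, B]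
  have h1 : Fin.append α β = A + B := by
    ext i; refine Fin.addCases (fun j => ?_) (fun j => ?_) i <;> simp [A, B]
  have h2 : Fin.append α (-β) = A - B := by
    ext i; refine Fin.addCases (fun j => ?_) (fun j => ?_) i <;> simp [A, B]
  have h3 : ∀ γ : ℝ, Fin.append (γ • α) 0 = γ • A := by
    intro γ
    ext i; refine Fin.addCases (fun j => ?_) (fun j => ?_) i <;> simp [A]
  have hl : ∀ C w, floss C w = ∫ x, (spl (x ⬝ᵥ w) - Real.sigmoid (x ⬝ᵥ C) * (x ⬝ᵥ w))
      ∂(Measure.pi fun _ : Fin (s + t) => gaussianReal 0 (Real.toNNReal (σ1 ^ 2))) := by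
    intro C w
    rw [← loss_eq, hfloss]
    rfl
  have hF : ∀ w, f w = ∫ x, (spl (x ⬝ᵥ w) - hh A B x * (x ⬝ᵥ w))
      ∂(Measure.pi fun _ : Fin (s + t) => gaussianReal 0 (Real.toNNReal (σ1 ^ 2))) := by
    intro w
    rw [hf, h1, h2, hl, hl, avg_eq]
  obtain ⟨γ, hγ, h⟩ := core σ1 hσ1 A B hAB
  refine ⟨γ, hγ, fun w hw => ?_⟩
  rw [h3] at hw ⊢
  rw [hF, hF]
  exact h w hw
end
end
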